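/- There exist universal constants C, C' > 0 such that for all integers n, K ≥ 1, all ε, δ ∈ (0,1), and every integer k with k ≥ C·(n·√(log(1/δ)/min(n,K)) + log(1/δ))/ε², there exists a randomized tester A taking ⌈C'·(K+k)⌉ i.i.d. samples from an unknown distribution q on [n] and ⌈C'·k⌉ i.i.d. samples from an unknown distribution p on [n] such that: for all PMFs p, q on Fin n, if p = q then A outputs YES with probability at least 1 − δ, and if d_TV(p,q) ≥ ε then A outputs YES with probability at most δ. -/

import Mathlib

open scoped BigOperators

/-- `p` is a probability mass function on the finite type `α`. -/
def IsPMF {α : Type*} [Fintype α] (p : α → ℝ) : Prop :=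
  (∀ a, 0 ≤ p a) ∧ ∑ a, p a = 1

/-- Total variation distance between two distributions on `Fin n`. -/
noncomputable def tvDist {n : ℕ} (p q : Fin n → ℝ) : ℝ :=
  (1 / 2) * ∑ i, |p i - q i|

/-- Probability that the randomized tester `A` outputs YES, when it is given `K₀` i.i.d.
samples from `q` and `k₀` i.i.d. samples from `p`. -/
noncomputable def acceptProb2 {n K₀ k₀ : ℕ} (q p : Fin n → ℝ)
    (A : (Fin K₀ → Fin n) → (Fin k₀ → Fin n) → ℝ) : ℝ :=
  ∑ x : Fin K₀ → Fin n, ∑ y : Fin k₀ → Fin n,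
    (∏ i, q (x i)) * (∏ j, p (y j)) * A x y

/-! ### Operators acting on functions of the label statistics -/

/-- sign attached to a label: `0` is an auxiliary sample, `1` a `q`-sample, `2` a `p`-sample -/
def lsgn (l : Fin 3) : ℝ := if l = 0 then 0 else if l = 1 then 1 else -1

/-- one label step -/
noncomputable def stepP (κ : Fin 3 → ℝ) (Φ : ℝ → ℝ → ℝ) : ℝ → ℝ → ℝ :=
  fun s u => κ 0 * Φ s u + κ 1 * Φ (s + 1) (u + 1) + κ 2 * Φ (s - 1) (u + 1)

/-- one Bernoulli step -/
noncomputable def stepB (r : ℝ) (ψ : ℕ → ℝ) : ℕ → ℝ :=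
  fun t => (1 - r) * ψ t + r * ψ (t + 1)

/-- number of samples at location `i` -/
def cnt {n M : ℕ} (z : Fin M → Fin n) (i : Fin n) : ℕ := ∑ j, if z j = i then 1 else 0

/-- signed sum of labels at location `i` -/
noncomputable def sS {n M : ℕ} (z : Fin M → Fin n) (l : Fin M → Fin 3) (i : Fin n) : ℝ :=
  ∑ j, if z j = i then lsgn (l j) else 0

/-- number of nonzero labels at location `i` -/
noncomputable def sQ {n M : ℕ} (z : Fin M → Fin n) (l : Fin M → Fin 3) (i : Fin n) : ℝ :=
  ∑ j, if z j = i then (lsgn (l j)) ^ 2 else 0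

lemma sum_fin_cons {M : ℕ} {α : Type*} [Fintype α] (f : (Fin (M + 1) → α) → ℝ) :
    ∑ x, f x = ∑ a, ∑ x', f (Fin.cons a x') := by
  rw [← Equiv.sum_comp (Fin.consEquiv (fun _ : Fin (M + 1) => α)), Fintype.sum_prod_type]
  rfl

lemma prod_update_aux {n : ℕ} (i₀ : Fin n) (A : Fin n → ℝ) (b : ℝ) :
    (∏ i, if i₀ = i then b else A i) = b * ∏ i ∈ Finset.univ.erase i₀, A i := by
  rw [← Finset.mul_prod_erase Finset.univ _ (Finset.mem_univ i₀)]
  simp only [if_true]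
  congr 1
  apply Finset.prod_congr rfl
  intro i hi
  rw [if_neg (Finset.ne_of_mem_erase hi).symm]

lemma label_factor {n : ℕ} (κ : Fin n → Fin 3 → ℝ) :
    ∀ (M : ℕ) (z : Fin M → Fin n) (Φ : Fin n → ℝ → ℝ → ℝ),
    ∑ l : Fin M → Fin 3, (∏ j, κ (z j) (l j)) * ∏ i, Φ i (sS z l i) (sQ z l i)
      = ∏ i, ((stepP (κ i))^[cnt z i] (Φ i)) 0 0 := by
  intro M
  induction M with
  | zero => intro z Φ; simp [sS, sQ, cnt]
  | succ M ih =>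
    intro z Φ
    rw [sum_fin_cons, Finset.sum_comm]
    set z' : Fin M → Fin n := fun j => z j.succ with hz'
    set Φ' : Fin n → ℝ → ℝ → ℝ := fun i => if z 0 = i then stepP (κ i) (Φ i) else Φ i with hΦ'
    have hR : ∏ i, ((stepP (κ i))^[cnt z i] (Φ i)) 0 0
        = ∏ i, ((stepP (κ i))^[cnt z' i] (Φ' i)) 0 0 := by
      apply Finset.prod_congr rfl
      intro i _
      have : cnt z i = cnt z' i + (if z 0 = i then 1 else 0) := by
        rw [cnt, Fin.sum_univ_succ, add_comm, cnt]
      rw [this, hΦ']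
      by_cases h : z 0 = i
      · simp [h, Function.iterate_succ_apply]
      · simp [h]
    rw [hR, ← ih z' Φ']
    apply Finset.sum_congr rfl
    intro l' _
    have hS : ∀ a i, sS z (Fin.cons a l') i = (if z 0 = i then lsgn a else 0) + sS z' l' i := by
      intro a i; simp [sS, Fin.sum_univ_succ, hz']
    have hQ : ∀ a i, sQ z (Fin.cons a l') i
        = (if z 0 = i then (lsgn a) ^ 2 else 0) + sQ z' l' i := by
      intro a i; simp [sQ, Fin.sum_univ_succ, hz']
    have hprod : ∀ a, (∏ i, Φ i (sS z (Fin.cons a l') i) (sQ z (Fin.cons a l') i))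
        = Φ (z 0) (lsgn a + sS z' l' (z 0)) ((lsgn a) ^ 2 + sQ z' l' (z 0))
          * ∏ i ∈ Finset.univ.erase (z 0), Φ i (sS z' l' i) (sQ z' l' i) := by
      intro a
      rw [← prod_update_aux]
      apply Finset.prod_congr rfl
      intro i _
      rw [hS, hQ]
      by_cases h : z 0 = i
      · simp [h]
      · simp [h]
    have hprod2 : (∏ i, Φ' i (sS z' l' i) (sQ z' l' i))
        = stepP (κ (z 0)) (Φ (z 0)) (sS z' l' (z 0)) (sQ z' l' (z 0))
          * ∏ i ∈ Finset.univ.erase (z 0), Φ i (sS z' l' i) (sQ z' l' i) := by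
      rw [← prod_update_aux]
      apply Finset.prod_congr rfl
      intro i _
      by_cases h : z 0 = i
      · simp [hΦ', h]
      · simp [hΦ', h]
    simp_rw [hprod, Fin.prod_univ_succ, Fin.cons_zero, Fin.cons_succ]
    rw [hprod2, Fin.sum_univ_three]
    have e1 : lsgn 0 = 0 := by simp [lsgn]
    have e2 : lsgn 1 = 1 := by simp [lsgn]
    have e3 : lsgn 2 = -1 := by simp [lsgn]
    rw [e1, e2, e3]
    simp only [stepP, hz']
    have a1 : ∀ x : ℝ, x + 1 = 1 + x := fun x => add_comm _ _
    have a2 : ∀ x : ℝ, x - 1 = -1 + x := fun x => by ring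
    simp only [a1, a2]
    norm_num
    ring

/-! ### Negative association of multinomial counts -/

lemma weier {ι : Type*} [DecidableEq ι] (r A B : ι → ℝ) (hr0 : ∀ i, 0 ≤ r i)
    (hr1 : ∀ i, r i ≤ 1) (hB : ∀ i, 0 ≤ B i) (hAB : ∀ i, B i ≤ A i) (s : Finset ι) :
    (∏ i ∈ s, A i) - ∑ z ∈ s, r z * (A z - B z) * ∏ i ∈ s.erase z, A i
      ≤ ∏ i ∈ s, ((1 - r i) * A i + r i * B i) := by
  induction s using Finset.induction_on with
  | empty => simp
  | insert a s ha ih =>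
    have hA : ∀ i, 0 ≤ A i := fun i => (hB i).trans (hAB i)
    rw [Finset.prod_insert ha, Finset.prod_insert ha, Finset.sum_insert ha,
      Finset.erase_insert ha]
    have h1 : ∑ z ∈ s, r z * (A z - B z) * ∏ i ∈ (insert a s).erase z, A i
        = A a * ∑ z ∈ s, r z * (A z - B z) * ∏ i ∈ s.erase z, A i := by
      rw [Finset.mul_sum]
      apply Finset.sum_congr rfl
      intro z hz
      have hza : a ≠ z := fun h => ha (h ▸ hz)
      rw [Finset.erase_insert_of_ne hza, Finset.prod_insert (by simp [ha])]
      ring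
    rw [h1]
    set Sg := ∑ z ∈ s, r z * (A z - B z) * ∏ i ∈ s.erase z, A i
    have hSg : 0 ≤ Sg := Finset.sum_nonneg fun z _ =>
      mul_nonneg (mul_nonneg (hr0 z) (sub_nonneg.2 (hAB z))) (Finset.prod_nonneg fun i _ => hA i)
    have h2 : 0 ≤ (1 - r a) * A a + r a * B a :=
      add_nonneg (mul_nonneg (sub_nonneg.2 (hr1 a)) (hA a)) (mul_nonneg (hr0 a) (hB a))
    have h3 := mul_le_mul_of_nonneg_left ih h2
    have h4 : 0 ≤ r a * (A a - B a) * Sg :=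
      mul_nonneg (mul_nonneg (hr0 a) (sub_nonneg.2 (hAB a))) hSg
    nlinarith

lemma na_lemma {n : ℕ} (r : Fin n → ℝ) (hr0 : ∀ i, 0 ≤ r i) (hr : ∑ i, r i = 1) :
    ∀ (M : ℕ) (ψ : Fin n → ℕ → ℝ), (∀ i t, 0 ≤ ψ i t) → (∀ i, Antitone (ψ i)) →
    ∑ z : Fin M → Fin n, (∏ j, r (z j)) * ∏ i, ψ i (cnt z i)
      ≤ ∏ i, ((stepB (r i))^[M] (ψ i)) 0 := by
  have hr1 : ∀ i, r i ≤ 1 := fun i => by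
    rw [← hr]; exact Finset.single_le_sum (fun i _ => hr0 i) (Finset.mem_univ i)
  intro M
  induction M with
  | zero => intro ψ _ _; simp [cnt]
  | succ M ih =>
    intro ψ h0 hanti
    rw [sum_fin_cons, Finset.sum_comm]
    simp only [Function.iterate_succ_apply]
    refine le_trans ?_ (ih (fun i => stepB (r i) (ψ i)) ?_ ?_)
    · apply Finset.sum_le_sum
      intro z' _
      have hprod : ∀ a, (∏ i, ψ i (cnt (Fin.cons a z' : Fin (M + 1) → Fin n) i))
          = ψ a (cnt z' a + 1) * ∏ i ∈ Finset.univ.erase a, ψ i (cnt z' i) := by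
        intro a
        rw [← prod_update_aux]
        apply Finset.prod_congr rfl
        intro i _
        have : cnt (Fin.cons a z' : Fin (M + 1) → Fin n) i
            = cnt z' i + (if a = i then 1 else 0) := by
          rw [cnt, Fin.sum_univ_succ, add_comm, cnt]
          simp only [Fin.cons_zero, Fin.cons_succ]
        rw [this]
        by_cases h : a = i
        · simp [h]
        · simp [h]
      simp_rw [hprod, Fin.prod_univ_succ, Fin.cons_zero, Fin.cons_succ]
      have hw := weier r (fun i => ψ i (cnt z' i)) (fun i => ψ i (cnt z' i + 1)) hr0 hr1
        (fun i => h0 _ _) (fun i => hanti i (Nat.le_succ _)) Finset.univ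
      have hp : 0 ≤ ∏ j, r (z' j) := Finset.prod_nonneg fun j _ => hr0 _
      have key : ∑ a, r a * (∏ j, r (z' j)) * (ψ a (cnt z' a + 1)
            * ∏ i ∈ Finset.univ.erase a, ψ i (cnt z' i))
          = (∏ j, r (z' j)) * ((∏ i, ψ i (cnt z' i))
            - ∑ a, r a * (ψ a (cnt z' a) - ψ a (cnt z' a + 1))
              * ∏ i ∈ Finset.univ.erase a, ψ i (cnt z' i)) := by
        have e : (∏ i, ψ i (cnt z' i)) = ∑ a, r a * (ψ a (cnt z' a)
            * ∏ i ∈ Finset.univ.erase a, ψ i (cnt z' i)) := by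
          simp_rw [fun a => Finset.mul_prod_erase Finset.univ (fun i => ψ i (cnt z' i))
            (Finset.mem_univ a)]
          rw [← Finset.sum_mul, hr, one_mul]
        rw [e, ← Finset.sum_sub_distrib, Finset.mul_sum]
        apply Finset.sum_congr rfl
        intro a _
        ring
      rw [key]
      exact mul_le_mul_of_nonneg_left hw hp
    · intro i t
      exact add_nonneg (mul_nonneg (sub_nonneg.2 (hr1 i)) (h0 _ _)) (mul_nonneg (hr0 i) (h0 _ _))
    · intro i a b hab
      have := hanti i hab
      have h2 := hanti i (Nat.succ_le_succ hab)
      exact add_le_add (mul_le_mul_of_nonneg_left this (sub_nonneg.2 (hr1 i)))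
        (mul_le_mul_of_nonneg_left h2 (hr0 i))


/-! ### Null moment generating function -/

/-- label weights -/
noncomputable def lw (α : ℝ) (l : Fin 3) : ℝ := if l = 0 then 1 - 2 * α else α

lemma lw_zero (α : ℝ) : lw α 0 = 1 - 2 * α := by simp [lw]
lemma lw_one (α : ℝ) : lw α 1 = α := by simp [lw]
lemma lw_two (α : ℝ) : lw α 2 = α := by rw [lw, if_neg (by decide)]

lemma exp_le_one_add_two {v : ℝ} (h0 : 0 ≤ v) (h1 : v ≤ 1) : Real.exp v ≤ 1 + 2 * v := by
  have h := Real.abs_exp_sub_one_le (x := v) (by rw [abs_of_nonneg h0]; exact h1)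
  rw [abs_of_nonneg h0] at h
  linarith [(abs_le.1 h).2]

lemma null_step {α a b c s u t : ℝ} (hα0 : 0 ≤ α) (hα : α ≤ 1 / 2) (hb : 0 ≤ b)
    (hab : b ≤ a) (hab2 : a ≤ 2 * b) (hs : |s| ≤ t) (ht : 1 ≤ t) (hbt : b * t ≤ 1 / 16) :
    stepP (lw α) (fun s u => Real.exp (a * s ^ 2 - b * u + c)) s u
      ≤ Real.exp ((a + 8 * α * a ^ 2) * s ^ 2 - b * u + (c + 4 * α * (a - b))) := by
  have h1 : stepP (lw α) (fun s u => Real.exp (a * s ^ 2 - b * u + c)) s u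
      = Real.exp (a * s ^ 2 - b * u + c) *
        (1 - 2 * α + 2 * α * (Real.exp (a - b) * Real.cosh (2 * a * s))) := by
    have e1 : Real.exp (a * (s + 1) ^ 2 - b * (u + 1) + c)
        = Real.exp (a * s ^ 2 - b * u + c) * (Real.exp (a - b) * Real.exp (2 * a * s)) := by
      rw [← Real.exp_add, ← Real.exp_add]; congr 1; ring
    have e2 : Real.exp (a * (s - 1) ^ 2 - b * (u + 1) + c)
        = Real.exp (a * s ^ 2 - b * u + c) * (Real.exp (a - b) * Real.exp (-(2 * a * s))) := by
      rw [← Real.exp_add, ← Real.exp_add]; congr 1; ring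
    simp only [stepP, lw_zero, lw_one, lw_two, e1, e2, Real.cosh_eq]
    ring
  rw [h1]
  have ha0 : 0 ≤ a := hb.trans hab
  set v := a - b + 2 * a ^ 2 * s ^ 2 with hv
  have hc : Real.exp (a - b) * Real.cosh (2 * a * s) ≤ Real.exp v := by
    rw [hv, Real.exp_add]
    apply mul_le_mul_of_nonneg_left _ (Real.exp_pos _).le
    refine (Real.cosh_le_exp_half_sq _).trans (le_of_eq ?_)
    congr 1; ring
  have hv0 : 0 ≤ v := by
    have : 0 ≤ 2 * a ^ 2 * s ^ 2 := by positivity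
    linarith
  have has : a * |s| ≤ 1 / 8 := by
    have := mul_le_mul hab2 hs (abs_nonneg s) (by linarith)
    linarith
  have hv1 : v ≤ 1 := by
    have h2 : (a * |s|) ^ 2 ≤ (1 / 8) ^ 2 := by
      apply pow_le_pow_left₀ (by positivity) has
    have h3 : (a * |s|) ^ 2 = a ^ 2 * s ^ 2 := by rw [mul_pow, sq_abs]
    have h4 : b ≤ 1 / 16 := by nlinarith
    nlinarith
  have h2 := exp_le_one_add_two hv0 hv1
  have h3 : 1 - 2 * α + 2 * α * (Real.exp (a - b) * Real.cosh (2 * a * s))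
      ≤ Real.exp (4 * α * v) := by
    have := Real.add_one_le_exp (4 * α * v)
    have h5 : 2 * α * (Real.exp (a - b) * Real.cosh (2 * a * s)) ≤ 2 * α * (1 + 2 * v) :=
      mul_le_mul_of_nonneg_left (hc.trans h2) (by linarith)
    linarith
  refine (mul_le_mul_of_nonneg_left h3 (Real.exp_pos _).le).trans (le_of_eq ?_)
  rw [← Real.exp_add]
  congr 1
  rw [hv]; ring

lemma null_iter {α b : ℝ} {t : ℕ} (hα0 : 0 ≤ α) (hα : α ≤ 1 / 2) (hb : 0 ≤ b)
    (ht : 1 ≤ t) (hbt : b * t ≤ 1 / 16) :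
    ∀ j : ℕ, ∀ s u : ℝ, |s| + j ≤ t →
    (stepP (lw α))^[j] (fun s u => Real.exp (b * s ^ 2 - b * u)) s u
      ≤ Real.exp ((b + 32 * α * b ^ 2 * j) * s ^ 2 - b * u + 128 * α ^ 2 * b ^ 2 * t * j) := by
  have ht' : (1 : ℝ) ≤ t := by exact_mod_cast ht
  intro j
  induction j with
  | zero => intro s u _; simp
  | succ j ih =>
    intro s u hsj
    push_cast at hsj
    rw [Function.iterate_succ_apply']
    have hj0 : (0 : ℝ) ≤ j := Nat.cast_nonneg j
    set a := b + 32 * α * b ^ 2 * j with ha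
    have hjt : (j : ℝ) ≤ t := by linarith [abs_nonneg s]
    have hab : b ≤ a := by
      have : 0 ≤ 32 * α * b ^ 2 * j := by positivity
      linarith
    have hbj : b * j ≤ 1 / 16 := (mul_le_mul_of_nonneg_left hjt hb).trans hbt
    have hab2 : a ≤ 2 * b := by
      have h1 : α * (b * j) ≤ 1 / 2 * (1 / 16) := mul_le_mul hα hbj (by positivity) (by norm_num)
      have h2 : b * (α * (b * j)) ≤ b * (1 / 2 * (1 / 16)) := mul_le_mul_of_nonneg_left h1 hb
      have : 32 * α * b ^ 2 * j = 32 * (b * (α * (b * j))) := by ring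
      linarith
    have hα1 : 0 ≤ 1 - 2 * α := by linarith
    have i0 := ih s u (by linarith)
    have i1 := ih (s + 1) (u + 1) (by
      have := abs_add_le s 1
      rw [abs_one] at this; linarith)
    have i2 := ih (s - 1) (u + 1) (by
      have := abs_sub s 1
      rw [abs_one] at this; linarith)
    have step1 : stepP (lw α) ((stepP (lw α))^[j] (fun s u => Real.exp (b * s ^ 2 - b * u))) s u
        ≤ stepP (lw α) (fun s u => Real.exp (a * s ^ 2 - b * u + 128 * α ^ 2 * b ^ 2 * t * j))
          s u := by
      simp only [stepP, lw_zero, lw_one, lw_two]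
      gcongr
    refine step1.trans ((null_step hα0 hα hb hab hab2 (t := t) (by linarith) ht' hbt).trans ?_)
    apply Real.exp_le_exp.2
    push_cast
    have h1 : a + 8 * α * a ^ 2 ≤ b + 32 * α * b ^ 2 * (j + 1) := by
      have : a ^ 2 ≤ (2 * b) ^ 2 := pow_le_pow_left₀ (hb.trans hab) hab2 2
      have h2 : α * a ^ 2 ≤ α * (2 * b) ^ 2 := mul_le_mul_of_nonneg_left this hα0
      rw [ha] at h2 ⊢
      nlinarith
    have h2 : 4 * α * (a - b) ≤ 128 * α ^ 2 * b ^ 2 * t := by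
      have : 4 * α * (a - b) = 128 * α ^ 2 * b ^ 2 * j := by rw [ha]; ring
      rw [this]; gcongr
    have h3 := mul_le_mul_of_nonneg_right h1 (sq_nonneg s)
    linarith

lemma null_mgf {α lam : ℝ} {t : ℕ} (hα0 : 0 ≤ α) (hα : α ≤ 1 / 2) (hl0 : 0 ≤ lam)
    (hl : lam ≤ 1 / 16) (ht : 1 ≤ t) :
    (stepP (lw α))^[t] (fun s u => Real.exp (lam * ((s ^ 2 - u) / t))) 0 0
      ≤ Real.exp (128 * α ^ 2 * lam ^ 2) := by
  have ht' : (0 : ℝ) < t := by exact_mod_cast ht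
  have h := null_iter (b := lam / t) hα0 hα (by positivity) ht
    (by rw [div_mul_cancel₀ _ ht'.ne']; exact hl) t 0 0 (by simp)
  have e : (fun s u : ℝ => Real.exp (lam * ((s ^ 2 - u) / t)))
      = fun s u => Real.exp (lam / t * s ^ 2 - lam / t * u) := by
    funext s u; congr 1; field_simp
  rw [e]
  refine h.trans (le_of_eq ?_)
  congr 1
  field_simp
  ring

/-! ### Moment generating function under the alternative -/

lemma iter_mono {κ : Fin 3 → ℝ} (hκ : ∀ l, 0 ≤ κ l) {Φ Ψ : ℝ → ℝ → ℝ} {U : ℝ}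
    (h : ∀ s u, u ≤ U → Φ s u ≤ Ψ s u) :
    ∀ (j : ℕ) (s u : ℝ), u + j ≤ U → (stepP κ)^[j] Φ s u ≤ (stepP κ)^[j] Ψ s u := by
  intro j
  induction j with
  | zero => intro s u hu; simpa using h s u (by simpa using hu)
  | succ j ih =>
    intro s u hu
    push_cast at hu
    rw [Function.iterate_succ_apply', Function.iterate_succ_apply']
    have i0 := ih s u (by linarith)
    have i1 := ih (s + 1) (u + 1) (by linarith)
    have i2 := ih (s - 1) (u + 1) (by linarith)
    have := hκ 0
    have := hκ 1
    have := hκ 2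
    simp only [stepP]
    gcongr

lemma iter_exp (κ : Fin 3 → ℝ) (C A B : ℝ) :
    ∀ (j : ℕ) (s u : ℝ), (stepP κ)^[j] (fun s u => Real.exp (C + A * s + B * u)) s u
      = (κ 0 + κ 1 * Real.exp (A + B) + κ 2 * Real.exp (-A + B)) ^ j
        * Real.exp (C + A * s + B * u) := by
  intro j
  induction j with
  | zero => intro s u; simp
  | succ j ih =>
    intro s u
    rw [Function.iterate_succ_apply']
    simp only [stepP, ih]
    have e1 : Real.exp (C + A * (s + 1) + B * (u + 1))
        = Real.exp (C + A * s + B * u) * Real.exp (A + B) := by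
      rw [← Real.exp_add]; congr 1; ring
    have e2 : Real.exp (C + A * (s - 1) + B * (u + 1))
        = Real.exp (C + A * s + B * u) * Real.exp (-A + B) := by
      rw [← Real.exp_add]; congr 1; ring
    rw [e1, e2]; ring

lemma iter_poly (κ : Fin 3 → ℝ) (hκ1 : κ 0 + κ 1 + κ 2 = 1) (ρ β : ℝ) (hρ : ρ = κ 1 - κ 2)
    (hβ : β = κ 1 + κ 2) :
    ∀ (j : ℕ) (c0 c1 c2 c3 c4 c5 : ℝ),
    (stepP κ)^[j] (fun s u => c0 + c1 * s + c2 * s ^ 2 + c3 * (s ^ 2 - u)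
        + c4 * ((s ^ 2 - u) * s) + c5 * (s ^ 2 - u) ^ 2) 0 0
      = c0 + c1 * (j * ρ) + c2 * (j * β + j * (j - 1) * ρ ^ 2) + c3 * (j * (j - 1) * ρ ^ 2)
        + c4 * (j * (j - 1) * (j - 2) * ρ ^ 3 + 2 * j * (j - 1) * β * ρ)
        + c5 * (j * (j - 1) * (j - 2) * (j - 3) * ρ ^ 4 + 4 * j * (j - 1) * (j - 2) * β * ρ ^ 2
          + 2 * j * (j - 1) * β ^ 2) := by
  intro j
  induction j with
  | zero => intro c0 c1 c2 c3 c4 c5; simp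
  | succ j ih =>
    intro c0 c1 c2 c3 c4 c5
    rw [Function.iterate_succ_apply]
    have e : stepP κ (fun s u => c0 + c1 * s + c2 * s ^ 2 + c3 * (s ^ 2 - u)
        + c4 * ((s ^ 2 - u) * s) + c5 * (s ^ 2 - u) ^ 2)
        = fun s u => (c0 + c1 * ρ + c2 * β) + (c1 + 2 * ρ * c2 + 2 * ρ * c3 + 2 * β * c4) * s
          + (c2 + 2 * ρ * c4 + 4 * β * c5) * s ^ 2 + (c3 + ρ * c4) * (s ^ 2 - u)
          + (c4 + 4 * ρ * c5) * ((s ^ 2 - u) * s) + c5 * (s ^ 2 - u) ^ 2 := by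
      funext s u
      have h0 : κ 0 = 1 - κ 1 - κ 2 := by linarith
      simp only [stepP, hρ, hβ, h0]
      ring
    rw [e, ih]
    push_cast
    ring

lemma exp_le_quad {x : ℝ} (h : |x| ≤ 1) : Real.exp x ≤ 1 + x + x ^ 2 := by
  have := Real.abs_exp_sub_one_sub_id_le h
  linarith [(abs_le.1 this).2]

lemma exp_neg_le_quad {x : ℝ} (h : -1 ≤ x) : Real.exp (-x) ≤ 1 - x + x ^ 2 := by
  by_cases h1 : x ≤ 1
  · have := exp_le_quad (x := -x) (by rw [abs_neg]; exact abs_le.2 ⟨h, h1⟩)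
    nlinarith
  · push Not at h1
    have : Real.exp (-x) ≤ 1 := Real.exp_le_one_iff.2 (by linarith)
    nlinarith

lemma alt_caseA {κ : Fin 3 → ℝ} (hκ : ∀ l, 0 ≤ κ l) (hκ1 : κ 0 + κ 1 + κ 2 = 1) {ρ β lam : ℝ}
    (hρ : ρ = κ 1 - κ 2) (hβ : β = κ 1 + κ 2) (hl0 : 0 ≤ lam) (hl : lam ≤ 1 / 80) {t : ℕ}
    (ht : 1 ≤ t) (hc : 16 * β ≤ t * ρ ^ 2) :
    (stepP κ)^[t] (fun s u => Real.exp (-lam * ((s ^ 2 - u) / t))) 0 0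
      ≤ Real.exp (-(1 / 2) * lam * t * ρ ^ 2) := by
  have ht' : (1 : ℝ) ≤ t := by exact_mod_cast ht
  have htp : (0 : ℝ) < t := by linarith
  have h0 := hκ 0
  have h1 := hκ 1
  have h2 := hκ 2
  have hρa : |ρ| ≤ 1 := by rw [hρ]; exact abs_le.2 ⟨by linarith, by linarith⟩
  have hβ1 : β ≤ 1 := by linarith
  have hβ0 : 0 ≤ β := by linarith
  have m := iter_mono hκ (Φ := fun s u => Real.exp (-lam * ((s ^ 2 - u) / t)))
    (Ψ := fun s u => Real.exp (lam * t * ρ ^ 2 / 4 + (-(lam * ρ)) * s + (lam / t) * u)) (U := t)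
    (by
      intro s u _
      apply Real.exp_le_exp.2
      have : 0 ≤ lam / t * (s - t * ρ / 2) ^ 2 := by positivity
      have e : lam / t * (s - t * ρ / 2) ^ 2
          = lam * t * ρ ^ 2 / 4 + (-(lam * ρ)) * s + (lam / t) * u
            - (-lam * ((s ^ 2 - u) / t)) := by
        field_simp; ring
      linarith) t 0 0 (by simp)
  refine m.trans ?_
  rw [iter_exp]
  simp only [mul_zero, add_zero]
  have hlt : lam / t ≤ lam := div_le_self hl0 ht'
  have hlt0 : 0 ≤ lam / t := by positivity
  have hlr : |lam * ρ| ≤ lam := by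
    rw [abs_mul, abs_of_nonneg hl0]; exact mul_le_of_le_one_right hl0 hρa
  have hlr' := abs_le.1 hlr
  have q1 := exp_le_quad (x := -(lam * ρ) + lam / t) (abs_le.2 ⟨by linarith, by linarith⟩)
  have q2 := exp_le_quad (x := - -(lam * ρ) + lam / t) (abs_le.2 ⟨by linarith, by linarith⟩)
  have b1 : κ 0 + κ 1 * Real.exp (-(lam * ρ) + lam / t) + κ 2 * Real.exp (- -(lam * ρ) + lam / t)
      ≤ Real.exp (-lam * ρ ^ 2 + lam / t * β + 2 * β * (lam ^ 2 * ρ ^ 2 + (lam / t) ^ 2)) := by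
    refine le_trans ?_ (Real.add_one_le_exp _)
    have g1 := mul_le_mul_of_nonneg_left q1 h1
    have g2 := mul_le_mul_of_nonneg_left q2 h2
    have g3 : κ 1 * (-(lam * ρ) + lam / t) ^ 2 ≤ κ 1 * (2 * (lam ^ 2 * ρ ^ 2 + (lam / t) ^ 2)) :=
      mul_le_mul_of_nonneg_left (by nlinarith [sq_nonneg (lam * ρ + lam / t)]) h1
    have g4 : κ 2 * (- -(lam * ρ) + lam / t) ^ 2 ≤ κ 2 * (2 * (lam ^ 2 * ρ ^ 2 + (lam / t) ^ 2)) :=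
      mul_le_mul_of_nonneg_left (by nlinarith [sq_nonneg (lam * ρ - lam / t)]) h2
    have e1 : κ 1 * (lam * ρ) - κ 2 * (lam * ρ) = lam * ρ ^ 2 := by rw [hρ]; ring
    have e2 : κ 1 * (lam / t) + κ 2 * (lam / t) = lam / t * β := by rw [hβ]; ring
    have e3 : κ 1 * (2 * (lam ^ 2 * ρ ^ 2 + (lam / t) ^ 2))
      + κ 2 * (2 * (lam ^ 2 * ρ ^ 2 + (lam / t) ^ 2))
      = 2 * β * (lam ^ 2 * ρ ^ 2 + (lam / t) ^ 2) := by rw [hβ]; ring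
    nlinarith
  have b2 := pow_le_pow_left₀ (by positivity) b1 t
  refine (mul_le_mul_of_nonneg_right b2 (Real.exp_pos _).le).trans ?_
  rw [← Real.exp_nat_mul, ← Real.exp_add]
  apply Real.exp_le_exp.2
  have e : (t : ℝ) * (-lam * ρ ^ 2 + lam / t * β + 2 * β * (lam ^ 2 * ρ ^ 2 + (lam / t) ^ 2))
      = -lam * (t * ρ ^ 2) + lam * β + 2 * β * lam * (lam * (t * ρ ^ 2))
        + 2 * β * lam * (lam / t) := by
    field_simp
    ring
  rw [e]
  set X := (t : ℝ) * ρ ^ 2 with hX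
  have hX0 : 0 ≤ X := by positivity
  have k1 : 2 * β * lam * (lam * X) ≤ 2 * 1 * (1 / 80) * (lam * X) := by gcongr
  have k2 : 2 * β * lam * (lam / t) ≤ lam * β := by
    have : (lam / t) ≤ 1 / 2 := by linarith
    have h3 : 0 ≤ 2 * β * lam := by positivity
    nlinarith
  have k3 : lam * (16 * β) ≤ lam * X := mul_le_mul_of_nonneg_left hc hl0
  have k4 : 0 ≤ lam * X := by positivity
  have e5 : lam * t * ρ ^ 2 / 4 = lam * X / 4 := by rw [hX]; ring
  have e6 : -(1 / 2) * lam * t * ρ ^ 2 = -(1 / 2) * (lam * X) := by rw [hX]; ring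
  rw [e5, e6]
  linarith

set_option maxHeartbeats 1000000 in
lemma alt_caseB {κ : Fin 3 → ℝ} (hκ : ∀ l, 0 ≤ κ l) (hκ1 : κ 0 + κ 1 + κ 2 = 1) {ρ β lam : ℝ}
    (hρ : ρ = κ 1 - κ 2) (hβ : β = κ 1 + κ 2) (hl0 : 0 ≤ lam) (hl : lam ≤ 1 / 80) {t : ℕ}
    (ht : 2 ≤ t) (hc : t * ρ ^ 2 ≤ 16 * β) :
    (stepP κ)^[t] (fun s u => Real.exp (-lam * ((s ^ 2 - u) / t))) 0 0
      ≤ Real.exp (-(1 / 2) * lam * (t - 1) * ρ ^ 2 + 2 * lam ^ 2 * β ^ 2) := by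
  have ht' : (2 : ℝ) ≤ t := by exact_mod_cast ht
  have htp : (0 : ℝ) < t := by linarith
  have h0 := hκ 0
  have h1 := hκ 1
  have h2 := hκ 2
  have hβ1 : β ≤ 1 := by linarith
  have hβ0 : 0 ≤ β := by linarith
  have m := iter_mono hκ (Φ := fun s u => Real.exp (-lam * ((s ^ 2 - u) / t)))
    (Ψ := fun s u => 1 + 0 * s + 0 * s ^ 2 + (-(lam / t)) * (s ^ 2 - u)
        + 0 * ((s ^ 2 - u) * s) + (lam / t) ^ 2 * (s ^ 2 - u) ^ 2) (U := t)
    (by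
      intro s u hu
      have hx : -1 ≤ lam * ((s ^ 2 - u) / t) := by
        have : -1 ≤ (s ^ 2 - u) / t := by
          rw [le_div_iff₀ htp]; nlinarith [sq_nonneg s]
        nlinarith
      have := exp_neg_le_quad hx
      rw [neg_mul]
      refine this.trans (le_of_eq ?_)
      field_simp
      ring) t 0 0 (by simp)
  refine m.trans ?_
  rw [iter_poly κ hκ1 ρ β hρ hβ]
  refine le_trans ?_ (Real.add_one_le_exp _)
  set X := (t : ℝ) * ρ ^ 2 with hX
  have hX0 : 0 ≤ X := by positivity
  have e : 1 + 0 * ((t : ℝ) * ρ) + 0 * (t * β + t * (t - 1) * ρ ^ 2)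
      + -(lam / t) * (t * (t - 1) * ρ ^ 2)
      + 0 * (t * (t - 1) * (t - 2) * ρ ^ 3 + 2 * t * (t - 1) * β * ρ)
      + (lam / t) ^ 2 * (t * (t - 1) * (t - 2) * (t - 3) * ρ ^ 4
        + 4 * t * (t - 1) * (t - 2) * β * ρ ^ 2 + 2 * t * (t - 1) * β ^ 2)
      = 1 - lam * ((t - 1) * ρ ^ 2) + lam ^ 2 * (((t - 1) / t) *
        ((t - 2) * (t - 3) * ρ ^ 4 + 4 * (t - 2) * β * ρ ^ 2 + 2 * β ^ 2)) := by
    field_simp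
    ring
  rw [e]
  have f1 : ((t : ℝ) - 1) / t ≤ 1 := by rw [div_le_one htp]; linarith
  have f0 : 0 ≤ ((t : ℝ) - 1) / t := div_nonneg (by linarith) htp.le
  have f2 : ((t : ℝ) - 2) * (t - 3) * ρ ^ 4 + 4 * (t - 2) * β * ρ ^ 2 + 2 * β ^ 2
      ≤ 2 * β ^ 2 + 20 * β * X := by
    have g1 : ((t : ℝ) - 2) * (t - 3) * ρ ^ 4 ≤ X * X := by
      have : ((t : ℝ) - 2) * (t - 3) ≤ t * t := by nlinarith
      have h4 : 0 ≤ ρ ^ 4 := by positivity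
      calc _ ≤ (t : ℝ) * t * ρ ^ 4 := mul_le_mul_of_nonneg_right this h4
        _ = X * X := by rw [hX]; ring
    have g2 : X * X ≤ 16 * β * X := mul_le_mul_of_nonneg_right hc hX0
    have g3 : 4 * ((t : ℝ) - 2) * β * ρ ^ 2 ≤ 4 * β * X := by
      have : 0 ≤ β * ρ ^ 2 := by positivity
      rw [hX]; nlinarith
    linarith
  have f3 : ((t : ℝ) - 1) / t * (((t : ℝ) - 2) * (t - 3) * ρ ^ 4 + 4 * (t - 2) * β * ρ ^ 2
      + 2 * β ^ 2) ≤ 2 * β ^ 2 + 20 * β * X := by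
    have h5 : 0 ≤ 2 * β ^ 2 + 20 * β * X := by positivity
    calc _ ≤ ((t : ℝ) - 1) / t * (2 * β ^ 2 + 20 * β * X) := mul_le_mul_of_nonneg_left f2 f0
      _ ≤ 1 * (2 * β ^ 2 + 20 * β * X) := mul_le_mul_of_nonneg_right f1 h5
      _ = _ := one_mul _
  have f4 := mul_le_mul_of_nonneg_left f3 (sq_nonneg lam)
  set Y := ((t : ℝ) - 1) * ρ ^ 2 with hY
  have hXY : X ≤ 2 * Y := by rw [hX, hY]; nlinarith [sq_nonneg ρ]
  have hY0 : 0 ≤ Y := by linarith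
  have f5 : 20 * β * X ≤ 40 * Y := by nlinarith
  have f6 : lam ^ 2 * (20 * β * X) ≤ lam ^ 2 * (40 * Y) :=
    mul_le_mul_of_nonneg_left f5 (sq_nonneg _)
  have f7 : lam ^ 2 * (40 * Y) ≤ 1 / 2 * (lam * Y) := by
    have h9 : 0 ≤ lam * Y := by positivity
    have h8 : lam * (lam * Y) ≤ 1 / 80 * (lam * Y) := mul_le_mul_of_nonneg_right hl h9
    have h7 : lam ^ 2 * (40 * Y) = 40 * (lam * (lam * Y)) := by ring
    linarith only [h8, h7]
  have e7 : -(1 / 2) * lam * (t - 1) * ρ ^ 2 = -(1 / 2) * (lam * Y) := by rw [hY]; ring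
  rw [e7]
  have e8 : lam ^ 2 * (2 * β ^ 2 + 20 * β * X)
      = 2 * lam ^ 2 * β ^ 2 + lam ^ 2 * (20 * β * X) := by ring
  rw [e8] at f4
  linarith only [f4, f6, f7]

lemma alt_mgf {κ : Fin 3 → ℝ} (hκ : ∀ l, 0 ≤ κ l) (hκ1 : κ 0 + κ 1 + κ 2 = 1) {ρ β lam α : ℝ}
    (hρ : ρ = κ 1 - κ 2) (hβ : β = κ 1 + κ 2) (hl0 : 0 ≤ lam) (hl : lam ≤ 1 / 80)
    (hαβ : β ^ 2 ≤ 64 * α ^ 2 + 4 * ρ ^ 2) {t : ℕ} (ht : 1 ≤ t) :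
    (stepP κ)^[t] (fun s u => Real.exp (-lam * ((s ^ 2 - u) / t))) 0 0
      ≤ Real.exp (128 * α ^ 2 * lam ^ 2) * Real.exp (-(lam * ρ ^ 2 / 4) * ((t - 1 : ℕ) : ℝ)) := by
  rcases Nat.lt_or_ge t 2 with h | h
  · have : t = 1 := by omega
    subst this
    simp only [Function.iterate_one, stepP]
    norm_num
    rw [hκ1]
    exact Real.one_le_exp (by positivity)
  · have ht' : (2 : ℝ) ≤ t := by exact_mod_cast h
    rw [Nat.cast_sub ht, Nat.cast_one, ← Real.exp_add]
    rcases le_total (16 * β) (t * ρ ^ 2) with hc | hc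
    · refine (alt_caseA hκ hκ1 hρ hβ hl0 hl ht hc).trans (Real.exp_le_exp.2 ?_)
      have h1 : 0 ≤ lam * ρ ^ 2 := by positivity
      have h2 : 0 ≤ 128 * α ^ 2 * lam ^ 2 := by positivity
      nlinarith
    · refine (alt_caseB hκ hκ1 hρ hβ hl0 hl h hc).trans (Real.exp_le_exp.2 ?_)
      have h1 : 0 ≤ lam * ρ ^ 2 := by positivity
      have h2 := mul_le_mul_of_nonneg_left hαβ (sq_nonneg lam)
      have h3 : lam * (lam * ρ ^ 2) ≤ 1 / 80 * (lam * ρ ^ 2) := mul_le_mul_of_nonneg_right hl h1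
      have h4 : lam * ρ ^ 2 ≤ (t - 1) * (lam * ρ ^ 2) := by nlinarith
      nlinarith

/-! ### Binomial bound -/

lemma stepB_iter_mono {r : ℝ} (hr0 : 0 ≤ r) (hr1 : r ≤ 1) {φ ψ : ℕ → ℝ} (h : ∀ t, φ t ≤ ψ t) :
    ∀ j t, (stepB r)^[j] φ t ≤ (stepB r)^[j] ψ t := by
  intro j
  induction j with
  | zero => simpa using h
  | succ j ih =>
    intro t
    rw [Function.iterate_succ_apply', Function.iterate_succ_apply']
    exact add_le_add (mul_le_mul_of_nonneg_left (ih _) (sub_nonneg.2 hr1))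
      (mul_le_mul_of_nonneg_left (ih _) hr0)

lemma stepB_iter_exp (r c x : ℝ) : ∀ j t : ℕ,
    (stepB r)^[j] (fun t => c * Real.exp (-x * t)) t
      = (1 - r * (1 - Real.exp (-x))) ^ j * (c * Real.exp (-x * t)) := by
  intro j
  induction j with
  | zero => simp
  | succ j ih =>
    intro t
    rw [Function.iterate_succ_apply']
    simp only [stepB, ih]
    have : Real.exp (-x * ((t + 1 : ℕ) : ℝ)) = Real.exp (-x * t) * Real.exp (-x) := by
      rw [← Real.exp_add]; congr 1; push_cast; ring
    rw [this]; ring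

lemma stepB_iter_zero (r c d : ℝ) : ∀ j t : ℕ,
    (stepB r)^[j] (fun t => c + d * if t = 0 then 1 else 0) t
      = c + d * (1 - r) ^ j * if t = 0 then 1 else 0 := by
  intro j
  induction j with
  | zero => simp
  | succ j ih =>
    intro t
    rw [Function.iterate_succ_apply']
    simp only [stepB, ih]
    rw [if_neg (Nat.succ_ne_zero t)]
    by_cases h : t = 0
    · rw [if_pos h]; ring
    · rw [if_neg h]; ring

lemma stepB_iter_shift (r : ℝ) (φ ψ : ℕ → ℝ) (h : ∀ t, 1 ≤ t → φ t = ψ t) :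
    ∀ j t : ℕ, 1 ≤ t → (stepB r)^[j] φ t = (stepB r)^[j] ψ t := by
  intro j
  induction j with
  | zero => simpa using h
  | succ j ih =>
    intro t ht
    rw [Function.iterate_succ_apply', Function.iterate_succ_apply']
    simp only [stepB, ih t ht, ih (t + 1) (by omega)]

lemma one_sub_pow_le {a : ℝ} (ha : a ≤ 1) (ha0 : 0 ≤ a) (h : ℕ) :
    (1 - a) ^ h ≤ 1 / (1 + h * a) := by
  have h0 : 0 ≤ 1 - a := by linarith
  have hpos : 0 < 1 + (h : ℝ) * a := by positivity
  rw [le_div_iff₀ hpos]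
  have h1 : (1 - a) ^ h ≤ Real.exp (-(h * a)) := by
    have : 1 - a ≤ Real.exp (-a) := by linarith [Real.add_one_le_exp (-a)]
    calc (1 - a) ^ h ≤ (Real.exp (-a)) ^ h := pow_le_pow_left₀ h0 this h
      _ = _ := by rw [← Real.exp_nat_mul]; congr 1; ring
  have h2 : 1 + (h : ℝ) * a ≤ Real.exp (h * a) := by linarith [Real.add_one_le_exp ((h : ℝ) * a)]
  calc _ ≤ Real.exp (-(h * a)) * Real.exp (h * a) := by gcongr
    _ = 1 := by rw [← Real.exp_add]; simp

lemma binom_bound {r x : ℝ} (hr0 : 0 ≤ r) (hr1 : r ≤ 1) (hx0 : 0 ≤ x) (hx : x ≤ 1 / 4) (h : ℕ) :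
    (stepB r)^[2 * h] (fun t => Real.exp (-x * ((t - 1 : ℕ) : ℝ))) 0
      ≤ Real.exp (-((h * r) ^ 2 * x / (4 * (1 + h * r)))) := by
  set x' := 1 - Real.exp (-x) with hx'
  have hx'1 : x / 2 ≤ x' := by
    have := exp_le_quad (x := -x) (by rw [abs_neg, abs_of_nonneg hx0]; linarith)
    rw [hx']; nlinarith
  have hx'0 : 0 ≤ x' := by linarith
  have hx'2 : x' ≤ 1 := by rw [hx']; linarith [Real.exp_pos (-x)]
  set y := (h : ℝ) * r with hy
  have hy0 : 0 ≤ y := by positivity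
  have goal' : y ^ 2 * x / (4 * (1 + y)) ≤ y ^ 2 * x' / (2 * (1 + y)) := by
    rw [div_le_div_iff₀ (by positivity) (by positivity)]
    have : 0 ≤ y ^ 2 * (1 + y) := by positivity
    nlinarith
  have hrx : r * x' ≤ 1 := mul_le_one₀ hr1 hx'0 hx'2
  have hrx0 : 0 ≤ r * x' := by positivity
  suffices H : (stepB r)^[2 * h] (fun t => Real.exp (-x * ((t - 1 : ℕ) : ℝ))) 0
      ≤ Real.exp (-(y ^ 2 * x' / (2 * (1 + y)))) from
    H.trans (Real.exp_le_exp.2 (by linarith))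
  rcases le_total (y * x') 1 with hc | hc
  · -- light case
    rw [two_mul, Function.iterate_add_apply]
    set γ := (1 - r * x') ^ h with hγ
    have hγ1 : γ ≤ 1 := pow_le_one₀ (by linarith) (by linarith)
    have hγ0 : 0 ≤ γ := pow_nonneg (by linarith) _
    have m1 : ∀ t, (stepB r)^[h] (fun t => Real.exp (-x * ((t - 1 : ℕ) : ℝ))) t
        ≤ γ + (1 - γ) * if t = 0 then 1 else 0 := by
      intro t
      by_cases ht : t = 0
      · have := stepB_iter_mono hr0 hr1 (φ := fun t => Real.exp (-x * ((t - 1 : ℕ) : ℝ)))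
          (ψ := fun t => 1 + 0 * if t = 0 then 1 else 0) (by
            intro t
            simp only [zero_mul, add_zero]
            apply Real.exp_le_one_iff.2
            have : (0 : ℝ) ≤ ((t - 1 : ℕ) : ℝ) := Nat.cast_nonneg _
            nlinarith) h t
        rw [stepB_iter_zero] at this
        rw [if_pos ht]
        linarith
      · have ht1 : 1 ≤ t := Nat.one_le_iff_ne_zero.2 ht
        rw [stepB_iter_shift r _ (fun t : ℕ => Real.exp x * Real.exp (-x * t)) (by
          intro t ht
          rw [← Real.exp_add, Nat.cast_sub ht]; congr 1; push_cast; ring) h t ht1,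
          stepB_iter_exp, if_neg ht, mul_zero, add_zero]
        apply mul_le_of_le_one_right hγ0
        rw [← Real.exp_add]
        apply Real.exp_le_one_iff.2
        have : (1 : ℝ) ≤ t := by exact_mod_cast ht1
        nlinarith
    refine (stepB_iter_mono hr0 hr1 m1 h 0).trans ?_
    rw [stepB_iter_zero]
    simp only [if_true, mul_one]
    have p1 := one_sub_pow_le hr1 hr0 h
    have p2 := one_sub_pow_le hrx hrx0 h
    rw [← hγ] at p2
    have e2 : (h : ℝ) * (r * x') = y * x' := by rw [hy]; ring
    rw [e2] at p2
    have p3 : γ ≤ 1 - y * x' / 2 := by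
      refine p2.trans ?_
      rw [div_le_iff₀ (by positivity)]
      have : 0 ≤ y * x' := by positivity
      nlinarith
    have p4 : γ + (1 - γ) * (1 - r) ^ h ≤ 1 - (y * x' / 2) * (y / (1 + y)) := by
      have e3 : 1 / (1 + (h : ℝ) * r) = 1 - y / (1 + y) := by
        rw [← hy]; field_simp; ring
      rw [e3] at p1
      have k1 := mul_le_mul_of_nonneg_left p1 (sub_nonneg.2 hγ1)
      have k2 : (y * x' / 2) * (y / (1 + y)) ≤ (1 - γ) * (y / (1 + y)) := by
        apply mul_le_mul_of_nonneg_right _ (by positivity); linarith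
      nlinarith
    refine p4.trans ?_
    have e4 : (y * x' / 2) * (y / (1 + y)) = y ^ 2 * x' / (2 * (1 + y)) := by field_simp
    rw [e4]
    linarith [Real.add_one_le_exp (-(y ^ 2 * x' / (2 * (1 + y))))]
  · have m2 := stepB_iter_mono hr0 hr1 (φ := fun t => Real.exp (-x * ((t - 1 : ℕ) : ℝ)))
      (ψ := fun t : ℕ => Real.exp x * Real.exp (-x * t)) (by
        intro t
        rw [← Real.exp_add]
        apply Real.exp_le_exp.2
        have : (t : ℝ) ≤ ((t - 1 : ℕ) : ℝ) + 1 := by exact_mod_cast (by omega : t ≤ t - 1 + 1)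
        nlinarith) (2 * h) 0
    refine m2.trans ?_
    rw [stepB_iter_exp]
    have h1 : (1 - r * x') ^ (2 * h) ≤ Real.exp (-(2 * (y * x'))) := by
      have : 1 - r * x' ≤ Real.exp (-(r * x')) := by linarith [Real.add_one_le_exp (-(r * x'))]
      calc _ ≤ (Real.exp (-(r * x'))) ^ (2 * h) := pow_le_pow_left₀ (by linarith) this _
        _ = _ := by rw [← Real.exp_nat_mul]; congr 1; push_cast; rw [hy]; ring
    simp only [Nat.cast_zero, mul_zero, Real.exp_zero, mul_one]
    refine (mul_le_mul_of_nonneg_right h1 (Real.exp_pos _).le).trans ?_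
    rw [← Real.exp_add]
    apply Real.exp_le_exp.2
    have h2 : y ^ 2 * x' / (2 * (1 + y)) ≤ y * x' := by
      rw [div_le_iff₀ (by positivity)]
      have : 0 ≤ y * x' := by positivity
      nlinarith
    linarith


/-! ### Sampling identities -/

lemma marg {ι κ α : Type*} [Fintype ι] [Fintype κ] [Fintype α] [DecidableEq ι] [DecidableEq κ]
    (q : α → ℝ) (hq : ∑ a, q a = 1) (e : ι ↪ κ) (g : (ι → α) → ℝ) :
    ∑ x : κ → α, (∏ i, q (x i)) * g (fun i => x (e i)) = ∑ u : ι → α, (∏ i, q (u i)) * g u := by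
  classical
  let E : ι ⊕ ((Set.range e)ᶜ : Set κ) ≃ κ :=
    (Equiv.sumCongr (Equiv.ofInjective e e.injective) (Equiv.refl _)).trans
      (Equiv.Set.sumCompl (Set.range e))
  have hE : ∀ i, E (Sum.inl i) = e i := by intro i; simp [E]
  let F : (ι → α) × (((Set.range e)ᶜ : Set κ) → α) ≃ (κ → α) :=
    (Equiv.sumArrowEquivProdArrow _ _ _).symm.trans (Equiv.arrowCongr E (Equiv.refl α))
  have hF1 : ∀ w i, F w (E (Sum.inl i)) = w.1 i := by intro w i; simp [F]; rfl
  have hF2 : ∀ w i, F w (E (Sum.inr i)) = w.2 i := by intro w i; simp [F]; rfl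
  rw [← Equiv.sum_comp F, Fintype.sum_prod_type]
  apply Finset.sum_congr rfl
  intro u _
  have h1 : ∀ v, (∏ i, q (F (u, v) i)) * g (fun i => F (u, v) (e i))
      = ((∏ i, q (u i)) * g u) * ∏ i, q (v i) := by
    intro v
    rw [← Equiv.prod_comp E, Fintype.prod_sum_type]
    simp only [hF1, hF2]
    have : (fun i => F (u, v) (e i)) = u := by
      funext i; rw [← hE, hF1]
    rw [this]; ring
  simp only [h1]
  rw [← Finset.mul_sum, ← Fintype.prod_sum (fun _ a => q a)]
  simp [hq]

/-- interleave samples according to labels -/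
def mix {n M K₀ k₀ : ℕ} (P : Fin M → Prop) [DecidablePred P] (f : Fin M ↪ Fin K₀)
    (e : {j // P j} ↪ Fin k₀) (x : Fin K₀ → Fin n) (y : Fin k₀ → Fin n) : Fin M → Fin n :=
  fun j => if h : P j then y (e ⟨j, h⟩) else x (f j)

lemma sampling {n M K₀ k₀ : ℕ} (P : Fin M → Prop) [DecidablePred P] (f : Fin M ↪ Fin K₀)
    (e : {j // P j} ↪ Fin k₀) (p q : Fin n → ℝ) (hp : ∑ a, p a = 1) (hq : ∑ a, q a = 1)
    (G : (Fin M → Fin n) → ℝ) :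
    ∑ x : Fin K₀ → Fin n, ∑ y : Fin k₀ → Fin n,
      (∏ i, q (x i)) * (∏ j, p (y j)) * G (mix P f e x y)
    = ∑ z : Fin M → Fin n, (∏ j, if P j then p (z j) else q (z j)) * G z := by
  let D := Equiv.piEquivPiSubtypeProd P (fun _ : Fin M => Fin n)
  let f' : {j // ¬ P j} ↪ Fin K₀ := (Function.Embedding.subtype _).trans f
  have hm : ∀ x y, mix P f e x y = D.symm (fun i => y (e i), fun i => x (f' i)) := by
    intro x y; funext j
    simp only [mix, D, Equiv.piEquivPiSubtypeProd_symm_apply]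
    rfl
  have s1 : ∀ x : Fin K₀ → Fin n, ∑ y : Fin k₀ → Fin n,
      (∏ i, q (x i)) * (∏ j, p (y j)) * G (mix P f e x y)
      = (∏ i, q (x i)) * ∑ u : {j // P j} → Fin n,
        (∏ j, p (u j)) * G (D.symm (u, fun i => x (f' i))) := by
    intro x
    rw [← marg p hp e (fun u => G (D.symm (u, fun i => x (f' i)))), Finset.mul_sum]
    apply Finset.sum_congr rfl
    intro y _
    rw [hm, mul_assoc]
  simp only [s1]
  rw [marg q hq f' (fun v => ∑ u : {j // P j} → Fin n, (∏ j, p (u j)) * G (D.symm (u, v)))]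
  rw [← Equiv.sum_comp D.symm, Fintype.sum_prod_type, Finset.sum_comm' (t' := Finset.univ)
    (s' := fun _ => Finset.univ) (by simp)]
  apply Finset.sum_congr rfl
  intro v _
  rw [Finset.mul_sum]
  apply Finset.sum_congr rfl
  intro u _
  have : (∏ j, if P j then p (D.symm (u, v) j) else q (D.symm (u, v) j))
      = (∏ j, p (u j)) * ∏ j, q (v j) := by
    rw [← Fintype.prod_subtype_mul_prod_subtype P]
    congr 1
    · apply Finset.prod_congr rfl
      intro j _
      simp [D, Equiv.piEquivPiSubtypeProd_symm_apply, j.2]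
    · apply Finset.prod_congr rfl
      intro j _
      simp [D, Equiv.piEquivPiSubtypeProd_symm_apply, j.2]
  rw [this]; ring

/-- the test statistic -/
noncomputable def Zst {n M : ℕ} (l : Fin M → Fin 3) (z : Fin M → Fin n) : ℝ :=
  ∑ i, ((sS z l i) ^ 2 - sQ z l i) / cnt z i

/-- joint expectation over labels and samples -/
noncomputable def jexp {n : ℕ} (M : ℕ) (α : ℝ) (p q : Fin n → ℝ)
    (F : (Fin M → Fin 3) → (Fin M → Fin n) → ℝ) : ℝ :=
  ∑ l : Fin M → Fin 3, ∑ z : Fin M → Fin n,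
    (∏ j, (lw α (l j) * if l j = 2 then p (z j) else q (z j))) * F l z

/-- the tester -/
noncomputable def tester {n : ℕ} (M : ℕ) {K₀ k₀ : ℕ} (α τ : ℝ) (hM : M ≤ K₀)
    (x : Fin K₀ → Fin n) (y : Fin k₀ → Fin n) : ℝ :=
  ∑ l : Fin M → Fin 3, (∏ j, lw α (l j)) *
    if h : Fintype.card {j // l j = 2} ≤ k₀ then
      (if Zst l (mix (fun j => l j = 2) (Fin.castLEEmb hM)
        (Function.Embedding.nonempty_of_card_le
          (by simpa using h) : Nonempty ({j // l j = 2} ↪ Fin k₀)).some x y) < τ then 1 else 0)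
    else 0

lemma lw_nonneg {α : ℝ} (h0 : 0 ≤ α) (h1 : α ≤ 1 / 2) (l : Fin 3) : 0 ≤ lw α l := by
  rw [lw]; split_ifs <;> linarith

lemma lw_sum (α : ℝ) : ∑ l, lw α l = 1 := by
  rw [Fin.sum_univ_three, lw_zero, lw_one, lw_two]; ring

lemma tester_bd {n M K₀ k₀ : ℕ} {α : ℝ} (τ : ℝ) (hM : M ≤ K₀) (h0 : 0 ≤ α) (h1 : α ≤ 1 / 2)
    (x : Fin K₀ → Fin n) (y : Fin k₀ → Fin n) :
    0 ≤ tester M α τ hM x y ∧ tester M α τ hM x y ≤ 1 := by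
  have hp : ∀ l : Fin M → Fin 3, 0 ≤ ∏ j, lw α (l j) := fun l =>
    Finset.prod_nonneg fun j _ => lw_nonneg h0 h1 _
  constructor
  · apply Finset.sum_nonneg
    intro l _
    apply mul_nonneg (hp l)
    split_ifs <;> norm_num
  · have : ∑ l : Fin M → Fin 3, (∏ j, lw α (l j)) = 1 := by
      rw [← Fintype.prod_sum (fun _ a => lw α a)]
      simp [lw_sum]
    rw [← this]
    apply Finset.sum_le_sum
    intro l _
    apply mul_le_of_le_one_right (hp l)
    split_ifs <;> norm_num

lemma accept_eq {n M K₀ k₀ : ℕ} {α : ℝ} (τ : ℝ) (hM : M ≤ K₀) (p q : Fin n → ℝ)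
    (hp : ∑ a, p a = 1) (hq : ∑ a, q a = 1) :
    acceptProb2 q p (tester (k₀ := k₀) M α τ hM) = jexp M α p q (fun l z =>
      if Fintype.card {j // l j = 2} ≤ k₀ ∧ Zst l z < τ then 1 else 0) := by
  rw [acceptProb2, jexp]
  simp only [tester, Finset.mul_sum]
  have : ∀ x : Fin K₀ → Fin n, ∀ T : (Fin k₀ → Fin n) → (Fin M → Fin 3) → ℝ,
      ∑ y, ∑ l, T y l = ∑ l, ∑ y, T y l := fun x T => Finset.sum_comm
  rw [Finset.sum_congr rfl fun x _ => this x _, Finset.sum_comm]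
  apply Finset.sum_congr rfl
  intro l _
  by_cases h : Fintype.card {j // l j = 2} ≤ k₀
  · simp only [h, dif_pos, true_and]
    have hs := sampling (fun j => l j = 2) (Fin.castLEEmb hM)
      (Function.Embedding.nonempty_of_card_le
          (by simpa using h) : Nonempty ({j // l j = 2} ↪ Fin k₀)).some p q hp hq
      (fun z => (∏ j, lw α (l j)) * if Zst l z < τ then 1 else 0)
    rw [hs]
    apply Finset.sum_congr rfl
    intro z _
    rw [Finset.prod_mul_distrib]; ring
  · simp only [h, dif_neg, false_and, not_false_iff, if_false, mul_zero, Finset.sum_const_zero]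

lemma jexp_mono {n M : ℕ} {α : ℝ} (h0 : 0 ≤ α) (h1 : α ≤ 1 / 2) {p q : Fin n → ℝ}
    (hp : ∀ a, 0 ≤ p a) (hq : ∀ a, 0 ≤ q a) {F G : (Fin M → Fin 3) → (Fin M → Fin n) → ℝ}
    (h : ∀ l z, F l z ≤ G l z) : jexp M α p q F ≤ jexp M α p q G := by
  apply Finset.sum_le_sum
  intro l _
  apply Finset.sum_le_sum
  intro z _
  apply mul_le_mul_of_nonneg_left (h l z)
  apply Finset.prod_nonneg
  intro j _
  apply mul_nonneg (lw_nonneg h0 h1 _)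
  split_ifs
  · exact hp _
  · exact hq _

lemma jexp_add {n M : ℕ} {α : ℝ} {p q : Fin n → ℝ}
    (F G : (Fin M → Fin 3) → (Fin M → Fin n) → ℝ) :
    jexp M α p q (fun l z => F l z + G l z) = jexp M α p q F + jexp M α p q G := by
  simp only [jexp, mul_add, Finset.sum_add_distrib]

lemma jexp_smul {n M : ℕ} {α : ℝ} {p q : Fin n → ℝ} (c : ℝ)
    (F : (Fin M → Fin 3) → (Fin M → Fin n) → ℝ) :
    jexp M α p q (fun l z => c * F l z) = c * jexp M α p q F := by
  simp only [jexp, Finset.mul_sum]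
  refine Finset.sum_congr rfl fun l _ => Finset.sum_congr rfl fun z _ => by ring

lemma jexp_prod {n M : ℕ} {α : ℝ} {p q : Fin n → ℝ} (hp : ∑ a, p a = 1) (hq : ∑ a, q a = 1)
    (w : Fin 3 → ℝ) :
    jexp M α p q (fun l _ => ∏ j, w (l j)) = (∑ a, lw α a * w a) ^ M := by
  rw [jexp]
  have : ∀ l : Fin M → Fin 3, ∑ z : Fin M → Fin n,
      (∏ j, (lw α (l j) * if l j = 2 then p (z j) else q (z j))) * ∏ j, w (l j)
      = ∏ j, lw α (l j) * w (l j) := by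
    intro l
    rw [← Finset.sum_mul, ← Fintype.prod_sum (fun j a => lw α (l j) * if l j = 2 then p a else q a),
      ← Finset.prod_mul_distrib]
    apply Finset.prod_congr rfl
    intro j _
    rw [← Finset.mul_sum]
    split_ifs
    · rw [hp, mul_one]
    · rw [hq, mul_one]
  simp only [this]
  rw [← Fintype.prod_sum (fun _ a => lw α a * w a)]
  simp

/-- joint moment generating function as a mixture -/
lemma jexp_mgf {n M : ℕ} {α : ℝ} {p q : Fin n → ℝ} (r : Fin n → ℝ) (κ : Fin n → Fin 3 → ℝ)
    (hκ : ∀ i l, (lw α l * if l = 2 then p i else q i) = r i * κ i l) (c : ℝ) :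
    jexp M α p q (fun l z => Real.exp (c * Zst l z))
      = ∑ z : Fin M → Fin n, (∏ j, r (z j)) * ∏ i, ((stepP (κ i))^[cnt z i]
          (fun s u => Real.exp (c * ((s ^ 2 - u) / cnt z i)))) 0 0 := by
  rw [jexp, Finset.sum_comm]
  apply Finset.sum_congr rfl
  intro z _
  rw [← label_factor κ M z (fun i s u => Real.exp (c * ((s ^ 2 - u) / cnt z i))), Finset.mul_sum]
  apply Finset.sum_congr rfl
  intro l _
  simp only [hκ]
  rw [Finset.prod_mul_distrib, ← Real.exp_sum, Zst, Finset.mul_sum]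
  ring

/-! ### Joint moment generating function bounds -/

lemma cnt_sum {n M : ℕ} (z : Fin M → Fin n) : ∑ i, cnt z i = M := by
  simp only [cnt]
  rw [Finset.sum_comm]
  simp

lemma occ_prod {n M : ℕ} (z : Fin M → Fin n) {E : ℝ} (hE : 1 ≤ E) :
    (∏ i, if cnt z i = 0 then 1 else E) ≤ E ^ (min n M) := by
  have h1 : (∏ i, if cnt z i = 0 then 1 else E)
      = E ^ (Finset.univ.filter (fun i => ¬ cnt z i = 0)).card := by
    rw [Finset.prod_ite]
    simp
  rw [h1]
  apply pow_le_pow_right₀ hE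
  apply le_min
  · exact (Finset.card_filter_le _ _).trans (by simp)
  · rw [Finset.card_filter]
    calc _ ≤ ∑ i, cnt z i := by
          apply Finset.sum_le_sum
          intro i _
          split_ifs <;> omega
      _ = M := cnt_sum z

lemma null_joint {n M : ℕ} {α lam : ℝ} {q : Fin n → ℝ} (hq0 : ∀ a, 0 ≤ q a) (hq : ∑ a, q a = 1)
    (hα0 : 0 ≤ α) (hα : α ≤ 1 / 2) (hl0 : 0 ≤ lam) (hl : lam ≤ 1 / 16) :
    jexp M α q q (fun l z => Real.exp (lam * Zst l z))
      ≤ Real.exp (128 * α ^ 2 * lam ^ 2) ^ (min n M) := by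
  rw [jexp_mgf q (fun _ => lw α) (by intro i l; simp [mul_comm])]
  have hE : 1 ≤ Real.exp (128 * α ^ 2 * lam ^ 2) := Real.one_le_exp (by positivity)
  have h1 : ∀ z : Fin M → Fin n, ∏ i, ((stepP (lw α))^[cnt z i]
          (fun s u => Real.exp (lam * ((s ^ 2 - u) / cnt z i)))) 0 0
      ≤ Real.exp (128 * α ^ 2 * lam ^ 2) ^ (min n M) := by
    intro z
    refine le_trans ?_ (occ_prod z hE)
    have hn : ∀ (t : ℕ) (c : ℝ), ∀ s u, 0 ≤ ((stepP (lw α))^[t]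
          (fun s u => Real.exp (lam * ((s ^ 2 - u) / c)))) s u := by
      intro t c
      induction t with
      | zero => intro s u; exact (Real.exp_pos _).le
      | succ t ih =>
        intro s u
        rw [Function.iterate_succ_apply']
        simp only [stepP]
        exact add_nonneg (add_nonneg (mul_nonneg (lw_nonneg hα0 hα _) (ih _ _))
          (mul_nonneg (lw_nonneg hα0 hα _) (ih _ _))) (mul_nonneg (lw_nonneg hα0 hα _) (ih _ _))
    apply Finset.prod_le_prod
    · intro i _; exact hn _ _ _ _
    · intro i _
      split_ifs with h
      · simp [h]
      · exact null_mgf hα0 hα hl0 hl (Nat.one_le_iff_ne_zero.2 h)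
  calc _ ≤ ∑ z : Fin M → Fin n, (∏ j, q (z j)) * Real.exp (128 * α ^ 2 * lam ^ 2) ^ (min n M) := by
        apply Finset.sum_le_sum
        intro z _
        exact mul_le_mul_of_nonneg_left (h1 z) (Finset.prod_nonneg fun j _ => hq0 _)
    _ = _ := by
        rw [← Finset.sum_mul, ← Fintype.prod_sum (fun _ a => q a)]
        simp [hq]

/-- mixture pmf -/
noncomputable def rmix (α p q : ℝ) : ℝ := (1 - α) * q + α * p

/-- conditional label law -/
noncomputable def kap (α p q : ℝ) (l : Fin 3) : ℝ :=
  if rmix α p q = 0 then lw α l else lw α l * (if l = 2 then p else q) / rmix α p q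

lemma kap_facts {α p q : ℝ} (hα0 : 0 ≤ α) (hα : α ≤ 1 / 2) (hp : 0 ≤ p) (hq : 0 ≤ q) :
    0 ≤ rmix α p q ∧
    (∀ l, (lw α l * if l = 2 then p else q) = rmix α p q * kap α p q l) ∧
    (∀ l, 0 ≤ kap α p q l) ∧ kap α p q 0 + kap α p q 1 + kap α p q 2 = 1 ∧
    (kap α p q 1 + kap α p q 2) ^ 2 ≤ 64 * α ^ 2 + 4 * (kap α p q 1 - kap α p q 2) ^ 2 ∧
    rmix α p q * (kap α p q 1 - kap α p q 2) = α * (q - p) := by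
  have hr0 : 0 ≤ rmix α p q := add_nonneg (mul_nonneg (by linarith) hq) (by positivity)
  have h20 : ¬ ((0 : Fin 3) = 2) := by decide
  have h21 : ¬ ((1 : Fin 3) = 2) := by decide
  by_cases hr : rmix α p q = 0
  · have hk : kap α p q = lw α := by funext l; rw [kap, if_pos hr]
    have hq' : q = 0 := by
      have h1 : 0 ≤ α * p := by positivity
      have h2 : (1 - α) * q + α * p = 0 := hr
      nlinarith
    have hp' : α * p = 0 := by
      have h2 : (1 - α) * q + α * p = 0 := hr
      rw [hq'] at h2; linarith
    refine ⟨hr0, ?_, ?_, ?_, ?_, ?_⟩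
    · intro l
      rw [hr, zero_mul]
      split_ifs with h
      · rw [h, lw_two, hp']
      · rw [hq', mul_zero]
    · rw [hk]; exact lw_nonneg hα0 hα
    · rw [hk, lw_zero, lw_one, lw_two]; ring
    · rw [hk, lw_one, lw_two]; nlinarith [sq_nonneg α]
    · rw [hr, hq', zero_mul]; linarith
  · have hrp : 0 < rmix α p q := lt_of_le_of_ne hr0 (Ne.symm hr)
    have hk : ∀ l, kap α p q l = lw α l * (if l = 2 then p else q) / rmix α p q := by
      intro l; rw [kap, if_neg hr]
    have k0 : kap α p q 0 = (1 - 2 * α) * q / rmix α p q := by rw [hk, lw_zero, if_neg h20]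
    have k1 : kap α p q 1 = α * q / rmix α p q := by rw [hk, lw_one, if_neg h21]
    have k2 : kap α p q 2 = α * p / rmix α p q := by rw [hk, lw_two, if_pos rfl]
    refine ⟨hr0, ?_, ?_, ?_, ?_, ?_⟩
    · intro l; rw [hk]; field_simp
    · intro l; rw [hk]
      apply div_nonneg _ hr0
      apply mul_nonneg (lw_nonneg hα0 hα l)
      split_ifs <;> assumption
    · rw [k0, k1, k2, ← add_div, ← add_div, div_eq_one_iff_eq hr, rmix]; ring
    · rw [k1, k2, ← add_div, ← sub_div, div_pow, div_pow]
      have hrr : 0 < rmix α p q ^ 2 := by positivity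
      have key : (α * q + α * p) ^ 2 ≤ 64 * α ^ 2 * rmix α p q ^ 2
          + 4 * (α * q - α * p) ^ 2 := by
        rcases le_total (3 * q) p with h | h
        · have : (q + p) ^ 2 ≤ 4 * (q - p) ^ 2 := by nlinarith
          have h3 := mul_le_mul_of_nonneg_left this (sq_nonneg α)
          have h4 : 0 ≤ 64 * α ^ 2 * rmix α p q ^ 2 := by positivity
          nlinarith
        · have h5 : q + p ≤ 8 * rmix α p q := by
            rw [rmix]
            have : 0 ≤ α * p := by positivity
            nlinarith
          have : (q + p) ^ 2 ≤ (8 * rmix α p q) ^ 2 := pow_le_pow_left₀ (by positivity) h5 2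
          have h3 := mul_le_mul_of_nonneg_left this (sq_nonneg α)
          nlinarith [sq_nonneg (α * q - α * p)]
      rw [div_le_iff₀ hrr, add_mul, mul_assoc 4, div_mul_cancel₀ _ hrr.ne']
      exact key
    · rw [k1, k2]; field_simp

lemma alt_joint {n h k : ℕ} {α lam ε : ℝ} {p q : Fin n → ℝ} (hp0 : ∀ a, 0 ≤ p a)
    (hp : ∑ a, p a = 1) (hq0 : ∀ a, 0 ≤ q a) (hq : ∑ a, q a = 1)
    (hα0 : 0 ≤ α) (hα : α ≤ 1 / 2) (hαk : h * α = k / 2) (hl0 : 0 ≤ lam) (hl : lam ≤ 1 / 80)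
    (hε : 0 ≤ ε) (hd : 2 * ε ≤ ∑ i, |p i - q i|) (hn1 : 1 ≤ n) :
    jexp (2 * h) α p q (fun l z => Real.exp (-lam * Zst l z))
      ≤ Real.exp (128 * α ^ 2 * lam ^ 2) ^ (min n (2 * h)) *
        Real.exp (-(lam * (k ^ 2 * ε ^ 2 / (16 * (n + h))))) := by
  set r : Fin n → ℝ := fun i => rmix α (p i) (q i) with hr
  set κ : Fin n → Fin 3 → ℝ := fun i => kap α (p i) (q i) with hκ
  have F : ∀ i, _ := fun i => kap_facts hα0 hα (hp0 i) (hq0 i)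
  set ρ : Fin n → ℝ := fun i => κ i 1 - κ i 2 with hρ
  have hrsum : ∑ i, r i = 1 := by
    simp only [hr, rmix, Finset.sum_add_distrib, ← Finset.mul_sum, hp, hq]; ring
  have hr0 : ∀ i, 0 ≤ r i := fun i => (F i).1
  have hr1 : ∀ i, r i ≤ 1 := fun i => by
    rw [← hrsum]; exact Finset.single_le_sum (fun j _ => hr0 j) (Finset.mem_univ i)
  have hρ1 : ∀ i, (ρ i) ^ 2 ≤ 1 := fun i => by
    have h0 := (F i).2.2.1 0
    have h1 := (F i).2.2.1 1
    have h2 := (F i).2.2.1 2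
    have h3 := (F i).2.2.2.1
    rw [sq_le_one_iff_abs_le_one]
    exact abs_le.2 ⟨by simp only [hρ, hκ]; linarith, by simp only [hρ, hκ]; linarith⟩
  rw [jexp_mgf r κ (fun i l => (F i).2.1 l)]
  set E := Real.exp (128 * α ^ 2 * lam ^ 2) with hEd
  have hE : 1 ≤ E := Real.one_le_exp (by positivity)
  set x : Fin n → ℝ := fun i => lam * ρ i ^ 2 / 4 with hx
  have hx0 : ∀ i, 0 ≤ x i := fun i => by simp only [hx]; positivity
  have hx1 : ∀ i, x i ≤ 1 / 4 := fun i => by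
    have := mul_le_mul hl (hρ1 i) (sq_nonneg _) (by norm_num)
    simp only [hx]; linarith
  have hn : ∀ (i : Fin n) (t : ℕ) (c : ℝ), ∀ s u, 0 ≤ ((stepP (κ i))^[t]
        (fun s u => Real.exp (-lam * ((s ^ 2 - u) / c)))) s u := by
    intro i t c
    have hk := (F i).2.2.1
    induction t with
    | zero => intro s u; exact (Real.exp_pos _).le
    | succ t ih =>
      intro s u
      rw [Function.iterate_succ_apply']
      simp only [stepP]
      exact add_nonneg (add_nonneg (mul_nonneg (hk _) (ih _ _))
        (mul_nonneg (hk _) (ih _ _))) (mul_nonneg (hk _) (ih _ _))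
  have h1 : ∀ z : Fin (2 * h) → Fin n, ∏ i, ((stepP (κ i))^[cnt z i]
          (fun s u => Real.exp (-lam * ((s ^ 2 - u) / cnt z i)))) 0 0
      ≤ E ^ (min n (2 * h)) * ∏ i, Real.exp (-x i * ((cnt z i - 1 : ℕ) : ℝ)) := by
    intro z
    refine le_trans ?_ (mul_le_mul_of_nonneg_right (occ_prod z hE)
      (Finset.prod_nonneg fun i _ => (Real.exp_pos _).le))
    rw [← Finset.prod_mul_distrib]
    apply Finset.prod_le_prod
    · intro i _; exact hn _ _ _ _ _
    · intro i _
      split_ifs with h0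
      · simp [h0]
      · exact alt_mgf (F i).2.2.1 (F i).2.2.2.1 rfl rfl hl0 hl (F i).2.2.2.2.1
          (Nat.one_le_iff_ne_zero.2 h0)
  have h2 : ∑ z : Fin (2 * h) → Fin n, (∏ j, r (z j)) *
      ∏ i, Real.exp (-x i * ((cnt z i - 1 : ℕ) : ℝ))
      ≤ ∏ i, ((stepB (r i))^[2 * h] (fun t => Real.exp (-x i * ((t - 1 : ℕ) : ℝ)))) 0 := by
    apply na_lemma r hr0 hrsum (2 * h) (fun i t => Real.exp (-x i * ((t - 1 : ℕ) : ℝ)))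
    · intro i t; exact (Real.exp_pos _).le
    · intro i s t hst
      apply Real.exp_le_exp.2
      have : ((s - 1 : ℕ) : ℝ) ≤ ((t - 1 : ℕ) : ℝ) := by exact_mod_cast Nat.sub_le_sub_right hst 1
      have := mul_le_mul_of_nonneg_left this (hx0 i)
      linarith
  have h3 : ∏ i, ((stepB (r i))^[2 * h] (fun t => Real.exp (-x i * ((t - 1 : ℕ) : ℝ)))) 0
      ≤ ∏ i, Real.exp (-((h * r i) ^ 2 * x i / (4 * (1 + h * r i)))) := by
    apply Finset.prod_le_prod
    · intro i _
      have := stepB_iter_mono (hr0 i) (hr1 i) (φ := fun _ => 0 + 0 * if (0 : ℕ) = 0 then 1 else 0)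
        (ψ := fun t => Real.exp (-x i * ((t - 1 : ℕ) : ℝ)))
        (by intro t; simp only [zero_mul, add_zero]; exact (Real.exp_pos _).le) (2 * h) 0
      refine le_trans (le_of_eq ?_) this
      have h9 := stepB_iter_zero (r i) 0 0 (2 * h) 0
      simp only [zero_mul, add_zero] at h9 ⊢
      exact h9.symm
    · intro i _
      exact binom_bound (hr0 i) (hr1 i) (hx0 i) (hx1 i) h
  have h4 : lam * (k ^ 2 * ε ^ 2 / (16 * (n + h)))
      ≤ ∑ i, (h * r i) ^ 2 * x i / (4 * (1 + h * r i)) := by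
    have hpos : ∀ i, 0 < 1 + h * r i := fun i => by have := hr0 i; positivity
    have e1 : ∀ i, (h * r i) ^ 2 * x i / (4 * (1 + h * r i))
        = lam * (k ^ 2 / 64) * (|p i - q i| ^ 2 / (1 + h * r i)) := by
      intro i
      have e2 : h * (r i * ρ i) = k / 2 * (q i - p i) := by
        have : r i * ρ i = α * (q i - p i) := (F i).2.2.2.2.2
        rw [this, ← mul_assoc, hαk]
      have e3 : (h * r i) ^ 2 * x i = lam * (h * (r i * ρ i)) ^ 2 / 4 := by
        simp only [hx]; ring
      rw [e3, e2, sq_abs]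
      have := (hpos i).ne'
      field_simp
      ring
    simp only [e1]
    rw [← Finset.mul_sum]
    have sed := Finset.sq_sum_div_le_sum_sq_div Finset.univ (fun i => |p i - q i|)
      (g := fun i => 1 + h * r i) (fun i _ => hpos i)
    have e4 : ∑ i, (1 + h * r i) = n + h := by
      rw [Finset.sum_add_distrib, ← Finset.mul_sum, hrsum]; simp
    rw [e4] at sed
    have hnh : (0 : ℝ) < n + h := by
      have : (1 : ℝ) ≤ n := by exact_mod_cast hn1
      positivity
    have sq2 : (2 * ε) ^ 2 ≤ (∑ i, |p i - q i|) ^ 2 := pow_le_pow_left₀ (by positivity) hd 2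
    have := (div_le_div_of_nonneg_right sq2 hnh.le).trans sed
    have := mul_le_mul_of_nonneg_left this (by positivity : 0 ≤ lam * ((k : ℝ) ^ 2 / 64))
    refine le_trans (le_of_eq ?_) this
    field_simp
    ring
  calc _ ≤ ∑ z : Fin (2 * h) → Fin n, E ^ (min n (2 * h)) * ((∏ j, r (z j)) *
      ∏ i, Real.exp (-x i * ((cnt z i - 1 : ℕ) : ℝ))) := by
        apply Finset.sum_le_sum
        intro z _
        rw [mul_left_comm]
        exact mul_le_mul_of_nonneg_left (h1 z) (Finset.prod_nonneg fun j _ => hr0 _)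
    _ ≤ _ := by
        rw [← Finset.mul_sum]
        apply mul_le_mul_of_nonneg_left _ (by positivity)
        refine h2.trans (h3.trans ?_)
        rw [← Real.exp_sum]
        apply Real.exp_le_exp.2
        rw [Finset.sum_neg_distrib]
        linarith

/-! ### Error bounds and parameters -/

lemma fallback {n h k k₀ : ℕ} {α : ℝ} {p q : Fin n → ℝ} (hp0 : ∀ a, 0 ≤ p a)
    (hp : ∑ a, p a = 1) (hq0 : ∀ a, 0 ≤ q a) (hq : ∑ a, q a = 1)
    (hα0 : 0 ≤ α) (hα : α ≤ 1 / 2) (hαk : h * α = k / 2) (hk : 4 * (k : ℝ) ≤ k₀) :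
    jexp (2 * h) α p q (fun l _ => if Fintype.card {j // l j = 2} ≤ k₀ then 0 else 1)
      ≤ Real.exp (-(2 * k)) := by
  have h1 : jexp (2 * h) α p q (fun l _ => if Fintype.card {j // l j = 2} ≤ k₀ then 0 else 1)
      ≤ jexp (2 * h) α p q (fun l _ => Real.exp (-(4 * k)) *
        ∏ j, (fun a : Fin 3 => if a = 2 then Real.exp 1 else 1) (l j)) := by
    apply jexp_mono hα0 hα hp0 hq0
    intro l _
    have e : ∏ j, (fun a : Fin 3 => if a = 2 then Real.exp 1 else 1) (l j)
        = Real.exp (Fintype.card {j // l j = 2}) := by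
      rw [Finset.prod_ite, Fintype.card_subtype]
      simp [← Real.exp_nat_mul]
    rw [e, ← Real.exp_add]
    split_ifs with hc
    · exact (Real.exp_pos _).le
    · apply Real.one_le_exp
      have : (k₀ : ℝ) ≤ (Fintype.card {j // l j = 2} : ℝ) := by exact_mod_cast (by omega)
      linarith
  refine h1.trans ?_
  rw [jexp_smul, jexp_prod hp hq (fun a : Fin 3 => if a = 2 then Real.exp 1 else 1)]
  have h2 : ∑ a : Fin 3, lw α a * (if a = 2 then Real.exp 1 else 1) ≤ Real.exp (2 * α) := by
    rw [Fin.sum_univ_three, lw_zero, lw_one, lw_two, if_neg (by decide), if_neg (by decide),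
      if_pos rfl]
    have := Real.exp_one_lt_d9
    have := Real.add_one_le_exp (2 * α)
    nlinarith
  have h0 : 0 ≤ ∑ a : Fin 3, lw α a * (if a = 2 then Real.exp 1 else 1) := by
    apply Finset.sum_nonneg
    intro a _
    apply mul_nonneg (lw_nonneg hα0 hα a)
    split_ifs
    · exact (Real.exp_pos _).le
    · norm_num
  have h3 := pow_le_pow_left₀ h0 h2 (2 * h)
  refine (mul_le_mul_of_nonneg_left h3 (Real.exp_pos _).le).trans (le_of_eq ?_)
  rw [← Real.exp_nat_mul, ← Real.exp_add]
  congr 1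
  push_cast
  linarith

lemma null_final {n h k k₀ : ℕ} {α lam τ : ℝ} {q : Fin n → ℝ} (hq0 : ∀ a, 0 ≤ q a)
    (hq : ∑ a, q a = 1)
    (hα0 : 0 ≤ α) (hα : α ≤ 1 / 2) (hαk : h * α = k / 2) (hk : 4 * (k : ℝ) ≤ k₀)
    (hl0 : 0 ≤ lam) (hl : lam ≤ 1 / 80) :
    1 - Real.exp (-(2 * k)) - Real.exp (-(lam * τ) + 128 * α ^ 2 * lam ^ 2 * (min n (2 * h) : ℕ))
      ≤ jexp (2 * h) α q q (fun l z =>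
        if Fintype.card {j // l j = 2} ≤ k₀ ∧ Zst l z < τ then 1 else 0) := by
  have one : jexp (2 * h) α q q (fun _ _ => 1) = 1 := by
    have := jexp_prod (M := 2 * h) (α := α) hq hq (fun _ => 1)
    simp only [Finset.prod_const_one, mul_one, lw_sum, one_pow] at this
    exact this
  have h1 : jexp (2 * h) α q q (fun _ _ => 1) ≤ jexp (2 * h) α q q (fun l z =>
      ((if Fintype.card {j // l j = 2} ≤ k₀ ∧ Zst l z < τ then 1 else 0)
        + (if Fintype.card {j // l j = 2} ≤ k₀ then 0 else 1))
        + Real.exp (-(lam * τ)) * Real.exp (lam * Zst l z)) := by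
    apply jexp_mono hα0 hα hq0 hq0
    intro l z
    have hpos : 0 < Real.exp (-(lam * τ)) * Real.exp (lam * Zst l z) := by positivity
    by_cases h1 : Fintype.card {j // l j = 2} ≤ k₀
    · by_cases h2 : Zst l z < τ
      · simp only [h1, h2, and_self, if_true]; linarith
      · simp only [h1, h2, and_false, if_true, if_false]
        rw [← Real.exp_add]
        have := Real.one_le_exp (x := -(lam * τ) + lam * Zst l z) (by
          have := mul_le_mul_of_nonneg_left (not_lt.1 h2) hl0
          linarith)
        linarith
    · simp only [h1, false_and, if_false]; linarith
  rw [one, jexp_add, jexp_add, jexp_smul] at h1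
  have h2 := fallback hq0 hq hq0 hq hα0 hα hαk hk
  have h3 := mul_le_mul_of_nonneg_left
    (null_joint (M := 2 * h) hq0 hq hα0 hα hl0 (by linarith : lam ≤ 1 / 16))
    (Real.exp_pos (-(lam * τ))).le
  rw [← Real.exp_nat_mul, ← Real.exp_add, mul_comm ((min n (2 * h) : ℕ) : ℝ)] at h3
  linarith

lemma alt_final {n h k k₀ : ℕ} {α lam ε τ : ℝ} {p q : Fin n → ℝ} (hp0 : ∀ a, 0 ≤ p a)
    (hp : ∑ a, p a = 1) (hq0 : ∀ a, 0 ≤ q a) (hq : ∑ a, q a = 1)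
    (hα0 : 0 ≤ α) (hα : α ≤ 1 / 2) (hαk : h * α = k / 2) (hl0 : 0 ≤ lam) (hl : lam ≤ 1 / 80)
    (hε : 0 ≤ ε) (hd : 2 * ε ≤ ∑ i, |p i - q i|) (hn1 : 1 ≤ n) :
    jexp (2 * h) α p q (fun l z =>
        if Fintype.card {j // l j = 2} ≤ k₀ ∧ Zst l z < τ then 1 else 0)
      ≤ Real.exp (lam * τ - lam * (k ^ 2 * ε ^ 2 / (16 * (n + h)))
        + 128 * α ^ 2 * lam ^ 2 * (min n (2 * h) : ℕ)) := by
  have h1 : jexp (2 * h) α p q (fun l z =>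
        if Fintype.card {j // l j = 2} ≤ k₀ ∧ Zst l z < τ then 1 else 0)
      ≤ jexp (2 * h) α p q (fun l z => Real.exp (lam * τ) * Real.exp (-lam * Zst l z)) := by
    apply jexp_mono hα0 hα hp0 hq0
    intro l z
    rw [← Real.exp_add]
    split_ifs with hc
    · apply Real.one_le_exp
      have := mul_le_mul_of_nonneg_left hc.2.le hl0
      linarith
    · exact (Real.exp_pos _).le
  refine h1.trans ?_
  rw [jexp_smul]
  have h3 := mul_le_mul_of_nonneg_left
    (alt_joint hp0 hp hq0 hq hα0 hα hαk hl0 hl hε hd hn1) (Real.exp_pos (lam * τ)).le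
  refine h3.trans (le_of_eq ?_)
  rw [← Real.exp_nat_mul, ← Real.exp_add, ← Real.exp_add]
  congr 1
  ring

lemma lam_exists {Δ a L : ℝ} (hL : 0 < L) (h1 : 640 * L ≤ Δ) (h2 : 4096 * a * L ≤ Δ ^ 2) :
    ∃ lam : ℝ, 0 ≤ lam ∧ lam ≤ 1 / 80 ∧ -(lam * (Δ / 2)) + 128 * a * lam ^ 2 ≤ -(2 * L) := by
  have hΔ : 0 < Δ := by linarith
  rcases le_total (80 * Δ) (512 * a) with h | h
  · have ha : 0 < a := by linarith
    refine ⟨Δ / (512 * a), by positivity, ?_, ?_⟩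
    · rw [div_le_div_iff₀ (by positivity) (by norm_num)]; linarith
    · have e : -(Δ / (512 * a) * (Δ / 2)) + 128 * a * (Δ / (512 * a)) ^ 2
          = -(Δ ^ 2 / (2048 * a)) := by
        field_simp
        ring
      rw [e]
      have : 2 * L ≤ Δ ^ 2 / (2048 * a) := by
        rw [le_div_iff₀ (by positivity)]; linarith
      linarith
  · refine ⟨1 / 80, by norm_num, le_refl _, ?_⟩
    linarith

lemma params {n m0 k m : ℕ} {ε L : ℝ} (hn : 1 ≤ n) (hm0 : 1 ≤ m0) (hm0n : m0 ≤ n) (hε0 : 0 < ε)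
    (hε1 : ε < 1) (hL : 0 < L) (hmn : m ≤ n) (hmh : m ≤ 2 * (m0 + k))
    (hk : 100000 * ((n : ℝ) * Real.sqrt (L / m0) + L) / ε ^ 2 ≤ k) :
    L ≤ k ∧ 640 * L ≤ (k : ℝ) ^ 2 * ε ^ 2 / (16 * (n + (m0 + k : ℕ))) ∧
    4096 * ((k / (2 * (m0 + k : ℕ)) : ℝ) ^ 2 * m) * L
      ≤ ((k : ℝ) ^ 2 * ε ^ 2 / (16 * (n + (m0 + k : ℕ)))) ^ 2 := by
  have hε2 : 0 < ε ^ 2 := by positivity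
  have hε21 : ε ^ 2 ≤ 1 := pow_le_one₀ hε0.le hε1.le
  rw [div_le_iff₀ hε2] at hk
  have hn' : (1 : ℝ) ≤ n := by exact_mod_cast hn
  have hm0' : (1 : ℝ) ≤ m0 := by exact_mod_cast hm0
  have hm0n' : (m0 : ℝ) ≤ n := by exact_mod_cast hm0n
  have hmn' : (m : ℝ) ≤ n := by exact_mod_cast hmn
  have hmh' : (m : ℝ) ≤ 2 * (m0 + k) := by exact_mod_cast hmh
  have hk0 : (0 : ℝ) ≤ k := Nat.cast_nonneg k
  have hmm : (0 : ℝ) ≤ m := Nat.cast_nonneg m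
  set S := Real.sqrt (L / m0) with hS
  have hS0 : 0 ≤ S := Real.sqrt_nonneg _
  have hS2 : S ^ 2 * m0 = L := by
    rw [hS, Real.sq_sqrt (by positivity)]; field_simp
  have hnS : 0 ≤ n * S := by positivity
  have b1 : 100000 * L ≤ k * ε ^ 2 := by linarith
  have b2 : 100000 * (n * S) ≤ k * ε ^ 2 := by linarith
  have b3 : (100000 * (n * S)) ^ 2 ≤ (k * ε ^ 2) ^ 2 := pow_le_pow_left₀ (by positivity) b2 2
  have b4 : (k : ℝ) * ε ^ 2 ≤ k := mul_le_of_le_one_right hk0 hε21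
  push_cast
  -- n * L ≤ n² S²
  have b5 : n * L ≤ (n * S) ^ 2 := by
    have : (n : ℝ) * (S ^ 2 * m0) ≤ n * (S ^ 2 * n) := by gcongr
    rw [hS2] at this
    linarith [this, (by ring : (n : ℝ) * (S ^ 2 * n) = (n * S) ^ 2)]
  have b6 : 10000000000 * (n * L) ≤ (k * ε ^ 2) ^ 2 := by
    have : (100000 * (n * S)) ^ 2 = 10000000000 * (n * S) ^ 2 := by ring
    linarith
  refine ⟨by linarith, ?_, ?_⟩
  · rw [le_div_iff₀ (by positivity)]
    have c1 : (k * ε ^ 2) ^ 2 ≤ k ^ 2 * ε ^ 2 := by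
      have : (k : ℝ) ^ 2 * ε ^ 2 * ε ^ 2 ≤ k ^ 2 * ε ^ 2 * 1 := by gcongr
      linarith [(by ring : ((k : ℝ) * ε ^ 2) ^ 2 = k ^ 2 * ε ^ 2 * ε ^ 2)]
    have c2 : k * (100000 * L) ≤ k * (k * ε ^ 2) := mul_le_mul_of_nonneg_left b1 hk0
    have c3 : m0 * L ≤ n * L := by gcongr
    have c4 : (0 : ℝ) ≤ n * L := by positivity
    have c5 : (0 : ℝ) ≤ k * L := by positivity
    have e : 640 * L * (16 * (n + (m0 + k))) = 10240 * (n * L + m0 * L + k * L) := by ring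
    rw [e]
    linarith [(by ring : (k : ℝ) * (k * ε ^ 2) = k ^ 2 * ε ^ 2)]
  · set H : ℝ := m0 + k with hH
    have hH0 : 0 < H := by positivity
    have hHm : (m0 : ℝ) ≤ H := by linarith
    have key : 262144 * (n + H) ^ 2 * m * L ≤ (k * ε ^ 2) ^ 2 * H ^ 2 := by
      rcases le_total (k : ℝ) n with hc | hc
      · have d1 : (n + H) ^ 2 ≤ (3 * n) ^ 2 := pow_le_pow_left₀ (by positivity) (by linarith) 2
        have d2 : 262144 * (n + H) ^ 2 * m * L ≤ 262144 * (3 * n) ^ 2 * (2 * H) * L := by gcongr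
        have d3 : (n : ℝ) ^ 2 * L * H ≤ (n * S) ^ 2 * H ^ 2 := by
          have : (n : ℝ) ^ 2 * S ^ 2 * H * m0 ≤ n ^ 2 * S ^ 2 * H * H := by gcongr
          rw [← hS2]; linarith [this, (by ring : (n : ℝ) ^ 2 * (S ^ 2 * m0) * H
            = n ^ 2 * S ^ 2 * H * m0), (by ring : (n * S) ^ 2 * H ^ 2 = n ^ 2 * S ^ 2 * H * H)]
        have d4 := mul_le_mul_of_nonneg_right b3 (sq_nonneg H)
        have d5 : 0 ≤ (n : ℝ) ^ 2 * L * H := by positivity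
        linarith [(by ring : 262144 * (3 * (n : ℝ)) ^ 2 * (2 * H) * L
          = 4718592 * (n ^ 2 * L * H)), (by ring : (100000 * (n * S)) ^ 2 * H ^ 2
          = 10000000000 * ((n * S) ^ 2 * H ^ 2))]
      · have d1 : (n + H) ^ 2 ≤ (2 * H) ^ 2 := pow_le_pow_left₀ (by positivity) (by linarith) 2
        have d2 : 262144 * (n + H) ^ 2 * m * L ≤ 262144 * (2 * H) ^ 2 * n * L := by gcongr
        have d4 := mul_le_mul_of_nonneg_right b6 (sq_nonneg H)
        have d5 : 0 ≤ n * L * H ^ 2 := by positivity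
        linarith [(by ring : 262144 * (2 * H) ^ 2 * n * L = 1048576 * (n * L * H ^ 2)),
          (by ring : 10000000000 * (n * L) * H ^ 2 = 10000000000 * (n * L * H ^ 2))]
    have hnH : 0 < n + H := by positivity
    have e1 : 4096 * ((k / (2 * H)) ^ 2 * m) * L = 1024 * k ^ 2 * m * L / H ^ 2 := by
      field_simp; ring
    have e2 : (k ^ 2 * ε ^ 2 / (16 * (n + H))) ^ 2
        = k ^ 2 * (k * ε ^ 2) ^ 2 / (256 * (n + H) ^ 2) := by
      field_simp; ring
    rw [e1, e2, div_le_div_iff₀ (by positivity) (by positivity)]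
    have := mul_le_mul_of_nonneg_left key (sq_nonneg (k : ℝ))
    linarith

/-- Closeness testing with unequal sized samples, upper bound
(Theorem 1.5, upper-bound part). -/
theorem closeness_unequal_samples_upper_bound :
    ∃ C > (0 : ℝ), ∃ C' > (0 : ℝ), ∀ n K : ℕ, 1 ≤ n → 1 ≤ K →
      ∀ ε δ : ℝ, 0 < ε → ε < 1 → 0 < δ → δ < 1 →
      ∀ k : ℕ,
        (k : ℝ) ≥ C * ((n : ℝ) * Real.sqrt (Real.log (1 / δ) / min (n : ℝ) (K : ℝ))
            + Real.log (1 / δ)) / ε ^ 2 →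
        ∃ A : (Fin ⌈C' * ((K : ℝ) + (k : ℝ))⌉₊ → Fin n) → (Fin ⌈C' * (k : ℝ)⌉₊ → Fin n) → ℝ,
          (∀ x y, 0 ≤ A x y ∧ A x y ≤ 1) ∧
          ∀ p q : Fin n → ℝ, IsPMF p → IsPMF q →
            (p = q → 1 - δ ≤ acceptProb2 q p A) ∧
            (ε ≤ tvDist p q → acceptProb2 q p A ≤ δ) := by
  refine ⟨100000, by norm_num, 4, by norm_num, ?_⟩
  intro n K hn hK ε δ hε0 hε1 hδ0 hδ1 k hk
  rcases le_or_gt (1 / 2) δ with hδ | hδ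
  · refine ⟨fun _ _ => 1 / 2, fun _ _ => by norm_num, ?_⟩
    intro p q hp hq
    have e : acceptProb2 (K₀ := ⌈(4 : ℝ) * ((K : ℝ) + (k : ℝ))⌉₊) (k₀ := ⌈(4 : ℝ) * (k : ℝ)⌉₊)
        q p (fun _ _ => 1 / 2) = 1 / 2 := by
      rw [acceptProb2]
      simp only [← Finset.sum_mul, ← Finset.mul_sum]
      rw [← Fintype.prod_sum (fun _ a => q a), ← Fintype.prod_sum (fun _ a => p a)]
      simp [hp.2, hq.2]
    rw [e]
    exact ⟨fun _ => by linarith, fun _ => hδ⟩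
  · set L := Real.log (1 / δ) with hLdef
    have hL : 0 < L := Real.log_pos (by rw [lt_div_iff₀ hδ0]; linarith)
    have hexp : Real.exp (-(2 * L)) = δ ^ 2 := by
      rw [hLdef, one_div, Real.log_inv]
      rw [show -(2 * -Real.log δ) = Real.log δ + Real.log δ by ring, Real.exp_add,
        Real.exp_log hδ0]; ring
    set m0 := min n K with hm0
    have hmin : min (n : ℝ) (K : ℝ) = (m0 : ℝ) := by rw [hm0, Nat.cast_min]
    rw [hmin] at hk
    have hm01 : 1 ≤ m0 := le_min hn hK
    set h := m0 + k with hh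
    obtain ⟨hLk, hp1, hp2⟩ := params (m := min n (2 * h)) hn hm01 (min_le_left _ _) hε0 hε1 hL
      (min_le_left _ _) (min_le_right _ _) hk
    rw [← hh] at hp1 hp2
    obtain ⟨lam, hl0, hl, hlL⟩ := lam_exists hL hp1 hp2
    set Δ := (k : ℝ) ^ 2 * ε ^ 2 / (16 * (n + (h : ℝ))) with hΔ
    set α : ℝ := k / (2 * (h : ℝ)) with hα
    have hhpos : (0 : ℝ) < h := by
      have : 1 ≤ h := by omega
      exact_mod_cast this
    have hkh : (k : ℝ) ≤ h := by exact_mod_cast (by omega : k ≤ h)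
    have hα0 : 0 ≤ α := by positivity
    have hα1 : α ≤ 1 / 2 := by
      rw [hα, div_le_div_iff₀ (by positivity) (by norm_num)]; linarith
    have hαk : h * α = k / 2 := by rw [hα]; field_simp
    have hM : 2 * h ≤ ⌈(4 : ℝ) * ((K : ℝ) + (k : ℝ))⌉₊ := by
      have h1 : 2 * h ≤ 4 * (K + k) := by
        have : m0 ≤ K := min_le_right _ _
        omega
      have h2 := Nat.le_ceil ((4 : ℝ) * ((K : ℝ) + (k : ℝ)))
      have h3 : ((4 * (K + k) : ℕ) : ℝ) ≤ (⌈(4 : ℝ) * ((K : ℝ) + (k : ℝ))⌉₊ : ℝ) := by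
        push_cast; exact h2
      exact h1.trans (by exact_mod_cast h3)
    have hδ2 : δ ^ 2 ≤ δ / 2 := by nlinarith
    refine ⟨tester (2 * h) α (Δ / 2) hM, fun x y => tester_bd _ _ hα0 hα1 x y, ?_⟩
    intro p q hp hq
    rw [accept_eq _ _ p q hp.2 hq.2]
    have hb : Real.exp (-(lam * (Δ / 2)) + 128 * α ^ 2 * lam ^ 2 * (min n (2 * h) : ℕ))
        ≤ δ ^ 2 := by
      rw [← hexp]
      apply Real.exp_le_exp.2
      linarith
    constructor
    · intro hpq
      subst hpq
      have := null_final (n := n) (τ := Δ / 2) hp.1 hp.2 hα0 hα1 hαk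
        (Nat.le_ceil ((4 : ℝ) * (k : ℝ))) hl0 hl
      have h2 : Real.exp (-(2 * (k : ℝ))) ≤ δ ^ 2 := by
        rw [← hexp]; apply Real.exp_le_exp.2; linarith
      linarith
    · intro hd
      have hd' : 2 * ε ≤ ∑ i, |p i - q i| := by rw [tvDist] at hd; linarith
      refine (alt_final hp.1 hp.2 hq.1 hq.2 hα0 hα1 hαk hl0 hl hε0.le hd' hn).trans ?_
      rw [← hΔ]
      have e : lam * (Δ / 2) - lam * Δ = -(lam * (Δ / 2)) := by ring
      rw [e]
      linarith
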